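/- arXiv:2112.04763 — 10 statements merged into one kernel-verified Lean document; each statement's English description precedes it below -/
import Mathlib

section
/- Let p ∈ [1,∞) and let d_M : M*_c(ℝ^n) × M*_c(ℝ^n) → [0,∞) be a metric (distance function) satisfying: (i) there exists a function f : (0,∞) → (0,∞) such that d_M(m·μ₁, m·μ₂) = f(m)·W_p(μ₁, μ₂) for every m > 0 and every μ₁, μ₂ ∈ P_c(ℝ^n); and (ii) there exists an unbounded subset Σ ⊆ ℝ^n such that for every m₀ > 0 there exist a radius r > 0 and a constant C > 0, both depending only on m₀, with sup_{x∈Σ} d_M(m₀·δ_x, m·δ_x) ≤ C for every m ∈ (m₀ − r, m₀ + r). Then f is constant: f ≡ λ for some λ > 0. -/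
open MeasureTheory ENNReal

/-- The `p`-Wasserstein distance between two (probability) measures on `ℝⁿ`:
`W_p(μ,ν) = (inf_π ∫ |x-y|^p dπ)^{1/p}`, the infimum running over all couplings of `μ` and `ν`. -/
noncomputable def Wp (n : ℕ) (p : ℝ)
    (μ ν : Measure (EuclideanSpace ℝ (Fin n))) : ℝ :=
  ((sInf {c : ℝ≥0∞ | ∃ π : Measure (EuclideanSpace ℝ (Fin n) × EuclideanSpace ℝ (Fin n)),
      π.map Prod.fst = μ ∧ π.map Prod.snd = ν ∧
      c = ∫⁻ q, edist q.1 q.2 ^ p ∂π}) ^ (1 / p)).toReal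

/-- `μ` has compact support. -/
def CompactSupp {n : ℕ} (μ : Measure (EuclideanSpace ℝ (Fin n))) : Prop :=
  ∃ K : Set (EuclideanSpace ℝ (Fin n)), IsCompact K ∧ μ Kᶜ = 0

/-- `μ ∈ M*_c(ℝⁿ)`: compactly supported, with positive finite mass. -/
def IsMcStar {n : ℕ} (μ : Measure (EuclideanSpace ℝ (Fin n))) : Prop :=
  CompactSupp μ ∧ μ Set.univ ≠ 0 ∧ μ Set.univ ≠ ⊤

/-- `μ ∈ P_c(ℝⁿ)`: compactly supported probability measure. -/
def IsPc {n : ℕ} (μ : Measure (EuclideanSpace ℝ (Fin n))) : Prop :=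
  CompactSupp μ ∧ μ Set.univ = 1

theorem Wp_dirac (n : ℕ) (p : ℝ) (hp : 1 ≤ p) (x y : EuclideanSpace ℝ (Fin n)) :
    Wp n p (Measure.dirac x) (Measure.dirac y) = dist x y := by
  have hset : {c : ℝ≥0∞ | ∃ π : Measure (EuclideanSpace ℝ (Fin n) × EuclideanSpace ℝ (Fin n)),
      π.map Prod.fst = Measure.dirac x ∧ π.map Prod.snd = Measure.dirac y ∧
      c = ∫⁻ q, edist q.1 q.2 ^ p ∂π} = {edist x y ^ p} := by
    ext c
    simp only [Set.mem_setOf_eq, Set.mem_singleton_iff]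
    constructor
    · rintro ⟨π, h1, h2, rfl⟩
      have a1 : ∀ᵐ q ∂π, q.1 = x := by
        have h : ∀ᵐ z ∂(π.map Prod.fst), z = x := by
          rw [h1, ae_dirac_eq]
          exact Filter.eventually_pure.2 rfl
        exact ae_of_ae_map measurable_fst.aemeasurable h
      have a2 : ∀ᵐ q ∂π, q.2 = y := by
        have h : ∀ᵐ z ∂(π.map Prod.snd), z = y := by
          rw [h2, ae_dirac_eq]
          exact Filter.eventually_pure.2 rfl
        exact ae_of_ae_map measurable_snd.aemeasurable h
      have hu : π Set.univ = 1 := by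
        have h := congrArg (fun μ => μ Set.univ) h1
        simpa [Measure.map_apply measurable_fst MeasurableSet.univ] using h
      have : ∫⁻ q, edist q.1 q.2 ^ p ∂π = ∫⁻ _q, edist x y ^ p ∂π := by
        apply lintegral_congr_ae
        filter_upwards [a1, a2] with q h1 h2
        rw [h1, h2]
      rw [this, lintegral_const, hu, mul_one]
    · rintro rfl
      refine ⟨Measure.dirac (x, y), ?_, ?_, ?_⟩
      · rw [Measure.map_dirac' measurable_fst]
      · rw [Measure.map_dirac' measurable_snd]
      · rw [lintegral_dirac]
  unfold Wp
  rw [hset, sInf_singleton, ← ENNReal.rpow_mul, mul_one_div_cancel (by linarith), ENNReal.rpow_one,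
    edist_dist, ENNReal.toReal_ofReal dist_nonneg]

theorem isPc_dirac {n : ℕ} (x : EuclideanSpace ℝ (Fin n)) : IsPc (Measure.dirac x) :=
  ⟨⟨{x}, isCompact_singleton, by
    rw [Measure.dirac_apply' _ (measurableSet_singleton x).compl]; simp⟩, by simp⟩

theorem isMcStar_dirac {n : ℕ} (m : ℝ) (hm : 0 < m) (x : EuclideanSpace ℝ (Fin n)) :
    IsMcStar (ENNReal.ofReal m • Measure.dirac x) := by
  obtain ⟨⟨K, hK, h0⟩, h1⟩ := isPc_dirac x
  refine ⟨⟨K, hK, ?_⟩, ?_, ?_⟩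
  · rw [Measure.smul_apply, h0, smul_zero]
  · rw [Measure.smul_apply, h1]; simpa using hm
  · rw [Measure.smul_apply, h1]; simp

theorem statement0 (n : ℕ) (p : ℝ) (hp : 1 ≤ p)
    (dM : Measure (EuclideanSpace ℝ (Fin n)) → Measure (EuclideanSpace ℝ (Fin n)) → ℝ)
    -- `dM` is a distance function on `M*_c(ℝⁿ)`
    (hnonneg : ∀ μ ν, IsMcStar μ → IsMcStar ν → 0 ≤ dM μ ν)
    (heq : ∀ μ ν, IsMcStar μ → IsMcStar ν → (dM μ ν = 0 ↔ μ = ν))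
    (hsymm : ∀ μ ν, IsMcStar μ → IsMcStar ν → dM μ ν = dM ν μ)
    (htri : ∀ μ ν ρ, IsMcStar μ → IsMcStar ν → IsMcStar ρ → dM μ ρ ≤ dM μ ν + dM ν ρ)
    -- (i) fiber condition: `dM(m μ₁, m μ₂) = f(m) W_p(μ₁, μ₂)`
    (f : ℝ → ℝ) (hf : ∀ m : ℝ, 0 < m → 0 < f m)
    (hfiber : ∀ m : ℝ, 0 < m → ∀ μ₁ μ₂, IsPc μ₁ → IsPc μ₂ →
      dM (ENNReal.ofReal m • μ₁) (ENNReal.ofReal m • μ₂) = f m * Wp n p μ₁ μ₂)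
    -- (ii) uniform local mass-change bound over an unbounded set `S` of Dirac base points
    (S : Set (EuclideanSpace ℝ (Fin n))) (hS : ¬ Bornology.IsBounded S)
    (hii : ∀ m₀ : ℝ, 0 < m₀ → ∃ r > (0 : ℝ), ∃ C > (0 : ℝ), ∀ m : ℝ, 0 < m →
      m ∈ Set.Ioo (m₀ - r) (m₀ + r) → ∀ x ∈ S,
      dM (ENNReal.ofReal m₀ • Measure.dirac x) (ENNReal.ofReal m • Measure.dirac x) ≤ C) :
    ∃ lam > (0 : ℝ), ∀ m : ℝ, 0 < m → f m = lam := by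
  have key : ∀ m₀ : ℝ, 0 < m₀ → ∃ r > (0 : ℝ), ∀ m : ℝ, 0 < m →
      m ∈ Set.Ioo (m₀ - r) (m₀ + r) → f m = f m₀ := by
    intro m₀ h₀
    obtain ⟨r, hr, C, hC, h⟩ := hii m₀ h₀
    refine ⟨r, hr, fun m hm hmr => ?_⟩
    by_contra hne
    apply hS
    rw [Metric.isBounded_iff]
    have hpos : 0 < |f m - f m₀| := abs_pos.2 (sub_ne_zero.2 hne)
    refine ⟨2 * C / |f m - f m₀|, fun x hx y hy => ?_⟩
    rw [le_div_iff₀ hpos]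
    have ax := isMcStar_dirac m₀ h₀ x
    have ay := isMcStar_dirac m₀ h₀ y
    have bx := isMcStar_dirac m hm x
    have bye := isMcStar_dirac m hm y
    have e0 := hfiber m₀ h₀ _ _ (isPc_dirac x) (isPc_dirac y)
    have e1 := hfiber m hm _ _ (isPc_dirac x) (isPc_dirac y)
    rw [Wp_dirac n p hp] at e0 e1
    have t1 := htri _ _ _ ax bx ay
    have t2 := htri _ _ _ bx bye ay
    have t3 := htri _ _ _ bx ax bye
    have t4 := htri _ _ _ ax ay bye
    have s1 := hsymm _ _ ax bx
    have s2 := hsymm _ _ ay bye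
    have c1 := h m hm hmr x hx
    have c2 := h m hm hmr y hy
    rcases abs_cases (f m - f m₀) with ⟨h', _⟩ | ⟨h', _⟩ <;> rw [h'] <;> linarith
  have hlc : IsLocallyConstant (fun m : Set.Ioi (0 : ℝ) => f m) := by
    rw [IsLocallyConstant.iff_eventually_eq]
    rintro ⟨m₀, h₀⟩
    obtain ⟨r, hr, h⟩ := key m₀ h₀
    have hn : ∀ᶠ m : ℝ in nhds m₀, m ∈ Set.Ioo (m₀ - r) (m₀ + r) :=
      Ioo_mem_nhds (by linarith) (by linarith)
    have hn' := (continuous_subtype_val (p := fun m : ℝ => m ∈ Set.Ioi (0 : ℝ))).continuousAt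
      (x := ⟨m₀, h₀⟩) |>.eventually hn
    filter_upwards [hn'] with m hm
    exact h m.1 m.2 hm
  haveI : PreconnectedSpace (Set.Ioi (0 : ℝ)) := Subtype.preconnectedSpace isPreconnected_Ioi
  refine ⟨f 1, hf 1 one_pos, fun m hm => ?_⟩
  exact hlc.apply_eq_of_preconnectedSpace ⟨m, hm⟩ ⟨1, Set.mem_Ioi.2 one_pos⟩
end

section
/- Let (X, d_X) be a Polish space and let d_P : P_c(X) × P_c(X) → [0,∞) be a bounded metric on the space of compactly supported probability measures on X. Let f : (0,∞) → (0,∞) be a Lipschitz, increasing function such that sup_{m₁≠m₂} |f(m₁) − f(m₂)|/|m₁ − m₂| ≤ 1/diam(P_c(X), d_P) and lim_{m→0⁺} f(m) = 0. Then the function d_{M₀} : M_c(X) × M_c(X) → [0,∞) defined by d_{M₀}(m₁·μ₁, m₂·μ₂) := |m₁ − m₂| + min{f(m₁), f(m₂)}·d_P(μ₁, μ₂) for m₁, m₂ > 0 and μ₁, μ₂ ∈ P_c(X), together with d_{M₀}(0, m·μ) = d_{M₀}(m·μ, 0) := m and d_{M₀}(0, 0) := 0, is a metric on M_c(X). -/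
open MeasureTheory ENNReal

section

variable {X : Type*} [MetricSpace X] [MeasurableSpace X]

/-- `μ` has compact support. -/
def CompactSuppGen (μ : Measure X) : Prop :=
  ∃ K : Set X, IsCompact K ∧ μ Kᶜ = 0

/-- `μ ∈ P_c(X)`: compactly supported probability measure. -/
def IsPcGen (μ : Measure X) : Prop :=
  CompactSuppGen μ ∧ μ Set.univ = 1

/-- `μ ∈ M_c(X)`: compactly supported, with finite mass (possibly the zero measure). -/
def IsMcGen (μ : Measure X) : Prop :=
  CompactSuppGen μ ∧ μ Set.univ ≠ ⊤

end

theorem mc_rep {X : Type*} [MetricSpace X] [MeasurableSpace X] (μ : Measure X)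
    (h : IsMcGen μ) : μ = 0 ∨ ∃ m : ℝ, 0 < m ∧ ∃ ν, IsPcGen ν ∧ μ = ENNReal.ofReal m • ν := by
  obtain ⟨⟨K, hK, hK0⟩, hfin⟩ := h
  by_cases h0 : μ = 0
  · exact Or.inl h0
  right
  have hu : μ Set.univ ≠ 0 := by
    intro h; exact h0 (Measure.measure_univ_eq_zero.mp h)
  refine ⟨(μ Set.univ).toReal, ENNReal.toReal_pos hu hfin, (μ Set.univ)⁻¹ • μ,
    ⟨⟨K, hK, ?_⟩, ?_⟩, ?_⟩
  · simp [hK0]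
  · simp [ENNReal.inv_mul_cancel hu hfin]
  · rw [ENNReal.ofReal_toReal hfin, smul_smul, ENNReal.mul_inv_cancel hu hfin, one_smul]

theorem statement2 {X : Type*} [MetricSpace X] [CompleteSpace X]
    [TopologicalSpace.SeparableSpace X] [MeasurableSpace X] [BorelSpace X] [Nonempty X]
    -- `dP` is a bounded distance function on `P_c(X)`
    (dP : Measure X → Measure X → ℝ)
    (hPnonneg : ∀ μ ν, IsPcGen μ → IsPcGen ν → 0 ≤ dP μ ν)
    (hPeq : ∀ μ ν, IsPcGen μ → IsPcGen ν → (dP μ ν = 0 ↔ μ = ν))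
    (hPsymm : ∀ μ ν, IsPcGen μ → IsPcGen ν → dP μ ν = dP ν μ)
    (hPtri : ∀ μ ν ρ, IsPcGen μ → IsPcGen ν → IsPcGen ρ → dP μ ρ ≤ dP μ ν + dP ν ρ)
    (B : ℝ) (hPbdd : ∀ μ ν, IsPcGen μ → IsPcGen ν → dP μ ν ≤ B)
    -- `f : (0,∞) → (0,∞)` is Lipschitz, increasing, with Lipschitz constant at most
    -- `1 / diam P_c(X)` (written multiplicatively) and `f(m) → 0` as `m → 0⁺`
    (f : ℝ → ℝ) (hfpos : ∀ m : ℝ, 0 < m → 0 < f m)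
    (hfmono : ∀ m₁ m₂ : ℝ, 0 < m₁ → m₁ < m₂ → f m₁ < f m₂)
    (hfLip : ∃ L : ℝ, ∀ m₁ m₂ : ℝ, 0 < m₁ → 0 < m₂ → |f m₁ - f m₂| ≤ L * |m₁ - m₂|)
    (hfdiam : ∀ m₁ m₂ : ℝ, 0 < m₁ → 0 < m₂ →
      |f m₁ - f m₂| * sSup {c : ℝ | ∃ μ ν, IsPcGen μ ∧ IsPcGen ν ∧ c = dP μ ν} ≤ |m₁ - m₂|)
    (hf0 : Filter.Tendsto f (nhdsWithin 0 (Set.Ioi 0)) (nhds 0))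
    -- `D` is the function `d_{M₀}` of the statement
    (D : Measure X → Measure X → ℝ)
    (hD : ∀ m₁ m₂ : ℝ, 0 < m₁ → 0 < m₂ → ∀ μ₁ μ₂, IsPcGen μ₁ → IsPcGen μ₂ →
      D (ENNReal.ofReal m₁ • μ₁) (ENNReal.ofReal m₂ • μ₂) =
        |m₁ - m₂| + min (f m₁) (f m₂) * dP μ₁ μ₂)
    (hD0r : ∀ m : ℝ, 0 < m → ∀ μ, IsPcGen μ → D 0 (ENNReal.ofReal m • μ) = m)
    (hD0l : ∀ m : ℝ, 0 < m → ∀ μ, IsPcGen μ → D (ENNReal.ofReal m • μ) 0 = m)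
    (hD00 : D 0 0 = 0) :
    -- `D` is a distance function on `M_c(X)`
    (∀ μ ν, IsMcGen μ → IsMcGen ν → 0 ≤ D μ ν) ∧
    (∀ μ ν, IsMcGen μ → IsMcGen ν → (D μ ν = 0 ↔ μ = ν)) ∧
    (∀ μ ν, IsMcGen μ → IsMcGen ν → D μ ν = D ν μ) ∧
    (∀ μ ν ρ, IsMcGen μ → IsMcGen ν → IsMcGen ρ → D μ ρ ≤ D μ ν + D ν ρ) := by
  have K1 : ∀ a b : ℝ, 0 < a → 0 < b → ∀ μ ν, IsPcGen μ → IsPcGen ν →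
      |f a - f b| * dP μ ν ≤ |a - b| := by
    intro a b ha hb μ ν hμ hν
    refine le_trans (mul_le_mul_of_nonneg_left ?_ (abs_nonneg _)) (hfdiam a b ha hb)
    refine le_csSup ⟨B, ?_⟩ ⟨μ, ν, hμ, hν, rfl⟩
    rintro c ⟨μ', ν', h1, h2, rfl⟩
    exact hPbdd _ _ h1 h2
  have hm : ∀ a b : ℝ, 0 < a → a ≤ b → f a ≤ f b := by
    intro a b ha hab
    rcases hab.eq_or_lt with rfl | h
    · exact le_rfl
    · exact (hfmono a b ha h).le
  have K2 : ∀ a : ℝ, 0 < a → ∀ μ ν, IsPcGen μ → IsPcGen ν → f a * dP μ ν ≤ a := by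
    intro a ha μ ν hμ hν
    have hd := hPnonneg μ ν hμ hν
    have ht : Filter.Tendsto (fun e => a + f e * dP μ ν) (nhdsWithin 0 (Set.Ioi 0))
        (nhds (a + 0 * dP μ ν)) := (hf0.mul_const _).const_add _
    rw [zero_mul, add_zero] at ht
    refine ge_of_tendsto ht ?_
    filter_upwards [Ioo_mem_nhdsGT ha] with e he
    have h1 := K1 a e ha he.1 μ ν hμ hν
    rw [abs_of_pos (sub_pos.mpr he.2)] at h1
    have h2 := mul_le_mul_of_nonneg_right (le_abs_self (f a - f e)) hd
    have h3 := he.1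
    nlinarith
  have hmin : ∀ a b : ℝ, 0 < a → 0 < b → 0 < min (f a) (f b) := fun a b ha hb =>
    lt_min (hfpos a ha) (hfpos b hb)
  have hPself : ∀ μ, IsPcGen μ → dP μ μ = 0 := fun μ h => (hPeq μ μ h h).2 rfl
  refine ⟨?_, ?_, ?_, ?_⟩
  · intro μ ν hμ hν
    rcases mc_rep μ hμ with rfl | ⟨a, ha, p, hp, rfl⟩ <;>
      rcases mc_rep ν hν with rfl | ⟨b, hb, q, hq, rfl⟩
    · exact hD00.ge
    · rw [hD0r b hb q hq]; exact hb.le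
    · rw [hD0l a ha p hp]; exact ha.le
    · rw [hD a b ha hb p q hp hq]
      exact add_nonneg (abs_nonneg _) (mul_nonneg (hmin a b ha hb).le (hPnonneg p q hp hq))
  · intro μ ν hμ hν
    constructor
    · rcases mc_rep μ hμ with rfl | ⟨a, ha, p, hp, rfl⟩ <;>
        rcases mc_rep ν hν with rfl | ⟨b, hb, q, hq, rfl⟩
      · exact fun _ => rfl
      · rw [hD0r b hb q hq]; intro h; exact absurd h hb.ne'
      · rw [hD0l a ha p hp]; intro h; exact absurd h ha.ne'
      · rw [hD a b ha hb p q hp hq]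
        intro h
        have h1 := mul_nonneg (hmin a b ha hb).le (hPnonneg p q hp hq)
        have h2 := abs_nonneg (a - b)
        have h3 : a - b = 0 := abs_eq_zero.mp (by linarith)
        have h4 : min (f a) (f b) * dP p q = 0 := by linarith
        have h5 : dP p q = 0 := (mul_eq_zero.mp h4).resolve_left (hmin a b ha hb).ne'
        rw [(hPeq p q hp hq).1 h5, sub_eq_zero.mp h3]
    · rintro rfl
      rcases mc_rep μ hμ with rfl | ⟨a, ha, p, hp, rfl⟩
      · exact hD00
      · rw [hD a a ha ha p p hp hp, hPself p hp]; simp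
  · intro μ ν hμ hν
    rcases mc_rep μ hμ with rfl | ⟨a, ha, p, hp, rfl⟩ <;>
      rcases mc_rep ν hν with rfl | ⟨b, hb, q, hq, rfl⟩
    · rfl
    · rw [hD0r b hb q hq, hD0l b hb q hq]
    · rw [hD0r a ha p hp, hD0l a ha p hp]
    · rw [hD a b ha hb p q hp hq, hD b a hb ha q p hq hp, abs_sub_comm, min_comm,
        hPsymm p q hp hq]
  · intro μ ν ρ hμ hν hρ
    rcases mc_rep μ hμ with rfl | ⟨a, ha, p, hp, rfl⟩ <;>
      rcases mc_rep ν hν with rfl | ⟨b, hb, q, hq, rfl⟩ <;>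
      rcases mc_rep ρ hρ with rfl | ⟨c, hc, r, hr, rfl⟩
    · linarith
    · linarith
    · rw [hD00, hD0r b hb q hq, hD0l b hb q hq]; linarith
    · rw [hD0r c hc r hr, hD0r b hb q hq, hD b c hb hc q r hq hr]
      have h1 := mul_nonneg (hmin b c hb hc).le (hPnonneg q r hq hr)
      have h2 := neg_abs_le (b - c)
      linarith
    · linarith
    · rw [hD a c ha hc p r hp hr, hD0l a ha p hp, hD0r c hc r hr]
      have hd := hPnonneg p r hp hr
      have h1 := mul_le_mul_of_nonneg_right (min_le_left (f a) (f c)) hd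
      have h2 := mul_le_mul_of_nonneg_right (min_le_right (f a) (f c)) hd
      have h3 := K2 a ha p r hp hr
      have h4 := K2 c hc p r hp hr
      rcases abs_cases (a - c) with ⟨h, _⟩ | ⟨h, _⟩ <;> linarith
    · rw [hD0l a ha p hp, hD0l b hb q hq, hD a b ha hb p q hp hq]
      have h1 := mul_nonneg (hmin a b ha hb).le (hPnonneg p q hp hq)
      have h2 := le_abs_self (a - b)
      linarith
    · rw [hD a c ha hc p r hp hr, hD a b ha hb p q hp hq, hD b c hb hc q r hq hr]
      have d1 := hPnonneg p q hp hq
      have d2 := hPnonneg q r hq hr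
      have d3 := hPnonneg p r hp hr
      have ht := hPtri p q r hp hq hr
      have habs := abs_sub_le a b c
      by_cases hb' : min a c ≤ b
      · have hfb : min (f a) (f c) ≤ f b := by
          rcases min_le_iff.mp hb' with h | h
          · exact (min_le_left _ _).trans (hm a b ha h)
          · exact (min_le_right _ _).trans (hm c b hc h)
        have e1 : min (f a) (f c) ≤ min (f a) (f b) := le_min (min_le_left _ _) hfb
        have e2 : min (f a) (f c) ≤ min (f b) (f c) := le_min hfb (min_le_right _ _)
        have e3 := mul_le_mul_of_nonneg_right e1 d1
        have e4 := mul_le_mul_of_nonneg_right e2 d2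
        have e5 := mul_le_mul_of_nonneg_left ht (hmin a c ha hc).le
        linarith
      · push Not at hb'
        obtain ⟨hba, hbc⟩ := lt_min_iff.mp hb'
        have fa := hm b a hb hba.le
        have fc := hm b c hb hbc.le
        rw [min_eq_right fa, min_eq_left fc, abs_of_pos (sub_pos.mpr hba),
          abs_of_neg (sub_neg.mpr hbc)]
        have h1 := mul_le_mul_of_nonneg_right (min_le_left (f a) (f c)) d3
        have h2 := mul_le_mul_of_nonneg_right (min_le_right (f a) (f c)) d3
        have h3 := K1 a b ha hb p r hp hr
        have h4 := K1 c b hc hb p r hp hr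
        rw [abs_of_nonneg (sub_nonneg.mpr fa), abs_of_pos (sub_pos.mpr hba)] at h3
        rw [abs_of_nonneg (sub_nonneg.mpr fc), abs_of_pos (sub_pos.mpr hbc)] at h4
        have h5 := mul_le_mul_of_nonneg_left ht (hfpos b hb).le
        rcases abs_cases (a - c) with ⟨h, _⟩ | ⟨h, _⟩ <;> linarith
end

section
/- Let (X, d_X) and (Y, d_Y) be metric spaces and let M := X × Y be equipped with a metric d_M : M × M → [0,∞) satisfying: (i) there exists a function f : X → (0,∞) such that d_M((x, y₁), (x, y₂)) = f(x)·d_Y(y₁, y₂) for every x ∈ X and every y₁, y₂ ∈ Y; and (ii) for every x₀ ∈ X there exist a radius r > 0 and a constant C > 0, both depending only on x₀, such that sup_{y∈Y} d_M((x₀, y), (x, y)) ≤ C for every x in the open ball B_r(x₀) ⊆ X. If X is connected and diam Y = +∞, then f is constant: f ≡ λ for some λ > 0. -/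
theorem statement4 {X Y : Type*} [MetricSpace X] [MetricSpace Y]
    [ConnectedSpace X] (hY : EMetric.diam (Set.univ : Set Y) = ⊤)
    -- `dM` is a distance function on `M = X × Y`
    (dM : X × Y → X × Y → ℝ)
    (hnonneg : ∀ a b : X × Y, 0 ≤ dM a b)
    (heq : ∀ a b : X × Y, dM a b = 0 ↔ a = b)
    (hsymm : ∀ a b : X × Y, dM a b = dM b a)
    (htri : ∀ a b c : X × Y, dM a c ≤ dM a b + dM b c)
    -- (i) fiber condition
    (f : X → ℝ) (hf : ∀ x : X, 0 < f x)
    (hfiber : ∀ (x : X) (y₁ y₂ : Y), dM (x, y₁) (x, y₂) = f x * dist y₁ y₂)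
    -- (ii) uniform local bound
    (hii : ∀ x₀ : X, ∃ r > (0 : ℝ), ∃ C > (0 : ℝ), ∀ x ∈ Metric.ball x₀ r, ∀ y : Y,
      dM (x₀, y) (x, y) ≤ C) :
    ∃ lam > (0 : ℝ), ∀ x : X, f x = lam := by
  have hunb : ∀ K : ℝ, ∃ y₁ y₂ : Y, K < dist y₁ y₂ := by
    intro K
    by_contra! h
    have h1 : EMetric.diam (Set.univ : Set Y) ≤ ENNReal.ofReal K := by
      apply Metric.ediam_le
      intro y₁ _ y₂ _
      rw [edist_dist]
      exact ENNReal.ofReal_le_ofReal (h y₁ y₂)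
    rw [hY] at h1
    exact ENNReal.ofReal_ne_top (top_le_iff.mp h1)
  have hloc : IsLocallyConstant f := by
    rw [IsLocallyConstant.iff_eventually_eq]
    intro x₀
    obtain ⟨r, hr, C, hC, h⟩ := hii x₀
    filter_upwards [Metric.ball_mem_nhds x₀ hr] with x hx
    by_contra hne
    have hpos : 0 < |f x - f x₀| := abs_pos.mpr (sub_ne_zero.mpr hne)
    obtain ⟨y₁, y₂, hy⟩ := hunb (2 * C / |f x - f x₀|)
    rw [div_lt_iff₀ hpos] at hy
    have a1 := h x hx y₁
    have a2 := h x hx y₂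
    have s1 := hsymm (x, y₁) (x₀, y₁)
    have s2 := hsymm (x, y₂) (x₀, y₂)
    have t1 := htri (x, y₁) (x₀, y₁) (x, y₂)
    have t2 := htri (x₀, y₁) (x₀, y₂) (x, y₂)
    have t3 := htri (x₀, y₁) (x, y₁) (x₀, y₂)
    have t4 := htri (x, y₁) (x, y₂) (x₀, y₂)
    have e1 := hfiber x y₁ y₂
    have e2 := hfiber x₀ y₁ y₂
    rcases abs_cases (f x - f x₀) with ⟨e, _⟩ | ⟨e, _⟩ <;> rw [e] at hy <;> nlinarith
  obtain ⟨x₀⟩ := (inferInstance : Nonempty X)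
  exact ⟨f x₀, hf x₀, fun x => hloc.apply_eq_of_preconnectedSpace x x₀⟩
end

section
/- Let (X, d_X) and (Y, d_Y) be metric spaces with diam Y = +∞, and let d_M be a metric on M := X × Y such that d_M((x, y₁), (x, y₂)) = f(x)·d_Y(y₁, y₂) for every x ∈ X, y₁, y₂ ∈ Y, for some f : X → (0,∞). Fix x₀ ∈ X and suppose there exist r > 0 and C > 0 with sup_{y∈Y} d_M((x₀, y), (x, y)) ≤ C for every x ∈ B_r(x₀). Then |f(x₁) − f(x₂)|·d_Y(y₁, y₂) ≤ 4C for every x₁, x₂ ∈ B_r(x₀) and every y₁, y₂ ∈ Y; in particular f is constant on the ball B_r(x₀). -/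
theorem statement5 {X Y : Type*} [MetricSpace X] [MetricSpace Y]
    (hY : EMetric.diam (Set.univ : Set Y) = ⊤)
    -- `dM` is a distance function on `M = X × Y`
    (dM : X × Y → X × Y → ℝ)
    (hnonneg : ∀ a b : X × Y, 0 ≤ dM a b)
    (heq : ∀ a b : X × Y, dM a b = 0 ↔ a = b)
    (hsymm : ∀ a b : X × Y, dM a b = dM b a)
    (htri : ∀ a b c : X × Y, dM a c ≤ dM a b + dM b c)
    -- fiber condition
    (f : X → ℝ) (hf : ∀ x : X, 0 < f x)
    (hfiber : ∀ (x : X) (y₁ y₂ : Y), dM (x, y₁) (x, y₂) = f x * dist y₁ y₂)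
    -- uniform bound near `x₀`
    (x₀ : X) (r C : ℝ) (hr : 0 < r) (hC : 0 < C)
    (hbound : ∀ x ∈ Metric.ball x₀ r, ∀ y : Y, dM (x₀, y) (x, y) ≤ C) :
    (∀ x₁ ∈ Metric.ball x₀ r, ∀ x₂ ∈ Metric.ball x₀ r, ∀ y₁ y₂ : Y,
      |f x₁ - f x₂| * dist y₁ y₂ ≤ 4 * C) ∧
    (∀ x₁ ∈ Metric.ball x₀ r, ∀ x₂ ∈ Metric.ball x₀ r, f x₁ = f x₂) := by
  have key : ∀ x₁ ∈ Metric.ball x₀ r, ∀ x₂ ∈ Metric.ball x₀ r, ∀ y₁ y₂ : Y,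
      (f x₁ - f x₂) * dist y₁ y₂ ≤ 4 * C := by
    intro x₁ h₁ x₂ h₂ y₁ y₂
    have a1 := htri (x₁, y₁) (x₀, y₁) (x₁, y₂)
    have a2 := htri (x₀, y₁) (x₂, y₁) (x₁, y₂)
    have a3 := htri (x₂, y₁) (x₂, y₂) (x₁, y₂)
    have a4 := htri (x₂, y₂) (x₀, y₂) (x₁, y₂)
    have b1 := hbound x₁ h₁ y₁
    have b2 := hbound x₂ h₂ y₁
    have b3 := hbound x₂ h₂ y₂
    have b4 := hbound x₁ h₁ y₂
    rw [hsymm] at b1 b3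
    rw [hfiber] at a1 a3
    linarith
  have main : ∀ x₁ ∈ Metric.ball x₀ r, ∀ x₂ ∈ Metric.ball x₀ r, ∀ y₁ y₂ : Y,
      |f x₁ - f x₂| * dist y₁ y₂ ≤ 4 * C := by
    intro x₁ h₁ x₂ h₂ y₁ y₂
    rcases abs_choice (f x₁ - f x₂) with h | h
    · rw [h]; exact key x₁ h₁ x₂ h₂ y₁ y₂
    · rw [h, neg_sub]; exact key x₂ h₂ x₁ h₁ y₁ y₂
  refine ⟨main, ?_⟩
  intro x₁ h₁ x₂ h₂
  by_contra hne
  have hpos : 0 < |f x₁ - f x₂| := abs_pos.mpr (sub_ne_zero.mpr hne)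
  have hle : Metric.ediam (Set.univ : Set Y) ≤ ENNReal.ofReal (4 * C / |f x₁ - f x₂|) := by
    refine Metric.ediam_le ?_
    intro y₁ _ y₂ _
    rw [edist_dist]
    apply ENNReal.ofReal_le_ofReal
    rw [le_div_iff₀ hpos, mul_comm]
    exact main x₁ h₁ x₂ h₂ y₁ y₂
  have hY' : Metric.ediam (Set.univ : Set Y) = ⊤ := hY
  rw [hY'] at hle
  exact ENNReal.ofReal_ne_top (top_le_iff.mp hle)
end

section
/- Let (X, d_X) and (Y, d_Y) be metric spaces with 0 < diam Y < +∞, and let f : X → (0,∞) be a function with M₀ := sup_{x∈X} f(x) < +∞. Then the function on (X × Y) × (X × Y) defined by d_M((x₁, y₁), (x₂, y₂)) := f(x₁)·d_Y(y₁, y₂) if x₁ = x₂, and d_M((x₁, y₁), (x₂, y₂)) := M₀·diam Y if x₁ ≠ x₂, is a metric on X × Y satisfying the fiber condition d_M((x, y₁), (x, y₂)) = f(x)·d_Y(y₁, y₂) and the uniform bound sup_{y∈Y} d_M((x₀, y), (x, y)) ≤ M₀·diam Y for all x₀, x ∈ X; in particular, when f is not constant this provides a metric satisfying conditions (i) and (ii)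 of the product-space theorem with non-constant f. -/
theorem statement7 {X Y : Type*} [MetricSpace X] [MetricSpace Y]
    -- `0 < diam Y < +∞`
    (hYbdd : Bornology.IsBounded (Set.univ : Set Y))
    (hYpos : 0 < Metric.diam (Set.univ : Set Y))
    -- `f : X → (0,∞)` with `M0 = sup_X f < +∞`
    (f : X → ℝ) (hf : ∀ x : X, 0 < f x)
    (M0 : ℝ) (hM0 : IsLUB (Set.range f) M0)
    -- `D` is the piecewise-defined function of the statement
    (D : X × Y → X × Y → ℝ)
    (hDeq : ∀ (x : X) (y₁ y₂ : Y), D (x, y₁) (x, y₂) = f x * dist y₁ y₂)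
    (hDne : ∀ (x₁ x₂ : X) (y₁ y₂ : Y), x₁ ≠ x₂ →
      D (x₁, y₁) (x₂, y₂) = M0 * Metric.diam (Set.univ : Set Y)) :
    -- `D` is a distance function on `X × Y`
    (∀ a b : X × Y, 0 ≤ D a b) ∧
    (∀ a b : X × Y, D a b = 0 ↔ a = b) ∧
    (∀ a b : X × Y, D a b = D b a) ∧
    (∀ a b c : X × Y, D a c ≤ D a b + D b c) ∧
    -- fiber condition
    (∀ (x : X) (y₁ y₂ : Y), D (x, y₁) (x, y₂) = f x * dist y₁ y₂) ∧
    -- uniform bound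
    (∀ (x₀ x : X) (y : Y), D (x₀, y) (x, y) ≤ M0 * Metric.diam (Set.univ : Set Y)) := by
  have hle : ∀ x (y₁ y₂ : Y), f x * dist y₁ y₂ ≤ M0 * Metric.diam (Set.univ : Set Y) := by
    intro x y₁ y₂
    have h1 : f x ≤ M0 := hM0.1 ⟨x, rfl⟩
    have h2 := Metric.dist_le_diam_of_mem hYbdd (Set.mem_univ y₁) (Set.mem_univ y₂)
    exact mul_le_mul h1 h2 dist_nonneg ((hf x).le.trans h1)
  have hpos : ∀ _ : X, 0 < M0 * Metric.diam (Set.univ : Set Y) := fun x =>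
    mul_pos ((hf x).trans_le (hM0.1 ⟨x, rfl⟩)) hYpos
  have hnn : ∀ a b : X × Y, 0 ≤ D a b := by
    rintro ⟨x₁, y₁⟩ ⟨x₂, y₂⟩
    by_cases h : x₁ = x₂
    · subst h
      rw [hDeq]
      exact mul_nonneg (hf _).le dist_nonneg
    · rw [hDne _ _ _ _ h]
      exact (hpos x₁).le
  refine ⟨hnn, ?_, ?_, ?_, hDeq, ?_⟩
  · rintro ⟨x₁, y₁⟩ ⟨x₂, y₂⟩
    by_cases h : x₁ = x₂
    · subst h
      rw [hDeq]
      simp [(hf x₁).ne']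
    · rw [hDne _ _ _ _ h]
      simp only [(hpos x₁).ne', false_iff]
      intro h'
      exact h (congrArg Prod.fst h')
  · rintro ⟨x₁, y₁⟩ ⟨x₂, y₂⟩
    by_cases h : x₁ = x₂
    · subst h
      rw [hDeq, hDeq, dist_comm]
    · rw [hDne _ _ _ _ h, hDne _ _ _ _ (Ne.symm h)]
  · rintro ⟨x₁, y₁⟩ ⟨x₂, y₂⟩ ⟨x₃, y₃⟩
    by_cases h : x₁ = x₂
    · subst h
      by_cases h' : x₁ = x₃
      · subst h'
        rw [hDeq, hDeq, hDeq, ← mul_add]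
        exact mul_le_mul_of_nonneg_left (dist_triangle _ _ _) (hf _).le
      · rw [hDne _ _ y₁ _ h', hDne _ _ y₂ _ h']
        linarith [hnn (x₁, y₁) (x₁, y₂)]
    · have h1 : D (x₁, y₁) (x₃, y₃) ≤ M0 * Metric.diam (Set.univ : Set Y) := by
        by_cases h' : x₁ = x₃
        · subst h'
          rw [hDeq]
          exact hle _ _ _
        · rw [hDne _ _ _ _ h']
      rw [hDne _ _ y₁ y₂ h]
      linarith [hnn (x₂, y₂) (x₃, y₃)]
  · intro x₀ x y
    by_cases h : x₀ = x
    · subst h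
      rw [hDeq]
      exact hle _ _ _
    · rw [hDne _ _ _ _ h]
end

section
/- Let (Y, d_Y) be a metric space with diam Y < +∞ and let f : (0,∞) → (0,∞) be a Lipschitz, increasing function such that sup_{x₁≠x₂} |f(x₁) − f(x₂)|/|x₁ − x₂| ≤ 1/diam Y. Then d_M((x₁, y₁), (x₂, y₂)) := |x₁ − x₂| + min{f(x₁), f(x₂)}·d_Y(y₁, y₂) is a metric on M := (0,∞) × Y satisfying: (i) d_M((x, y₁), (x, y₂)) = f(x)·d_Y(y₁, y₂) for every x > 0 and y₁, y₂ ∈ Y; and (ii') for every x₀ > 0 there exist r > 0 and C > 0 such that sup_{y∈Y} d_M((x₁, y), (x₂, y)) ≤ C·|x₁ − x₂| for every x₁, x₂ ∈ (x₀ − r, x₀ + r). -/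
/-- The function `d_M((x₁,y₁),(x₂,y₂)) = |x₁ - x₂| + min{f(x₁), f(x₂)} d_Y(y₁,y₂)`
on `ℝ × Y` (to be restricted to `(0,∞) × Y`). -/
noncomputable def dMin {Y : Type*} [MetricSpace Y] (f : ℝ → ℝ) (a b : ℝ × Y) : ℝ :=
  |a.1 - b.1| + min (f a.1) (f b.1) * dist a.2 b.2

theorem statement8 {Y : Type*} [MetricSpace Y]
    -- `diam Y < +∞`
    (hYbdd : Bornology.IsBounded (Set.univ : Set Y))
    -- `f : (0,∞) → (0,∞)` is Lipschitz, increasing, with Lipschitz constant at most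
    -- `1 / diam Y` (written multiplicatively)
    (f : ℝ → ℝ) (hfpos : ∀ x : ℝ, 0 < x → 0 < f x)
    (hfmono : ∀ x₁ x₂ : ℝ, 0 < x₁ → x₁ < x₂ → f x₁ < f x₂)
    (hfLip : ∃ L : ℝ, ∀ x₁ x₂ : ℝ, 0 < x₁ → 0 < x₂ → |f x₁ - f x₂| ≤ L * |x₁ - x₂|)
    (hfdiam : ∀ x₁ x₂ : ℝ, 0 < x₁ → 0 < x₂ →
      |f x₁ - f x₂| * Metric.diam (Set.univ : Set Y) ≤ |x₁ - x₂|) :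
    -- `dMin f` is a distance function on `M = (0,∞) × Y`
    (∀ a b : ℝ × Y, 0 < a.1 → 0 < b.1 → 0 ≤ dMin f a b) ∧
    (∀ a b : ℝ × Y, 0 < a.1 → 0 < b.1 → (dMin f a b = 0 ↔ a = b)) ∧
    (∀ a b : ℝ × Y, 0 < a.1 → 0 < b.1 → dMin f a b = dMin f b a) ∧
    (∀ a b c : ℝ × Y, 0 < a.1 → 0 < b.1 → 0 < c.1 →
      dMin f a c ≤ dMin f a b + dMin f b c) ∧
    -- (i) fiber condition
    (∀ x : ℝ, 0 < x → ∀ y₁ y₂ : Y, dMin f (x, y₁) (x, y₂) = f x * dist y₁ y₂) ∧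
    -- (ii') local Lipschitz bound in the first variable, uniformly in `y`
    (∀ x₀ : ℝ, 0 < x₀ → ∃ r > (0 : ℝ), ∃ C > (0 : ℝ),
      ∀ x₁ ∈ Set.Ioo (x₀ - r) (x₀ + r), ∀ x₂ ∈ Set.Ioo (x₀ - r) (x₀ + r), ∀ y : Y,
        dMin f (x₁, y) (x₂, y) ≤ C * |x₁ - x₂|) := by
  have hd : ∀ p q : Y, dist p q ≤ Metric.diam (Set.univ : Set Y) := fun p q =>
    Metric.dist_le_diam_of_mem hYbdd (Set.mem_univ p) (Set.mem_univ q)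
  have hmin : ∀ a b : ℝ, 0 < a → 0 < b → 0 < min (f a) (f b) := fun a b ha hb =>
    lt_min (hfpos a ha) (hfpos b hb)
  have hlt : ∀ a b : ℝ, 0 < a → 0 < b → f a < f b → a < b := by
    intro a b ha hb h
    by_contra hn
    rcases (not_lt.mp hn).lt_or_eq with h1 | h1
    · exact absurd (hfmono b a hb h1) (not_lt.mpr h.le)
    · rw [h1] at h
      exact lt_irrefl _ h
  have key : ∀ a b : ℝ, 0 < a → 0 < b → f a < f b → ∀ p q : Y,
      (f b - f a) * dist p q ≤ b - a := by
    intro a b ha hb h p q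
    have h1 := hfdiam b a hb ha
    rw [abs_of_pos (sub_pos.mpr h), abs_of_pos (sub_pos.mpr (hlt a b ha hb h))] at h1
    exact (mul_le_mul_of_nonneg_left (hd p q) (sub_pos.mpr h).le).trans h1
  refine ⟨?_, ?_, ?_, ?_, ?_, ?_⟩
  · intro a b ha hb
    have := hmin _ _ ha hb
    unfold dMin
    positivity
  · rintro ⟨a, p⟩ ⟨b, q⟩ ha hb
    have hm := hmin _ _ ha hb
    unfold dMin
    constructor
    · intro h
      have h1 : 0 ≤ min (f a) (f b) * dist p q := mul_nonneg hm.le dist_nonneg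
      have h2 := abs_nonneg (a - b)
      dsimp only at h hm
      have h3 : |a - b| = 0 := by linarith
      have h4 : min (f a) (f b) * dist p q = 0 := by linarith
      have h5 : a = b := sub_eq_zero.mp (abs_eq_zero.mp h3)
      have h6 : p = q := dist_eq_zero.mp ((mul_eq_zero.mp h4).resolve_left hm.ne')
      rw [h5, h6]
    · intro h
      obtain ⟨rfl, rfl⟩ := Prod.mk.inj h
      simp
  · intro a b _ _
    unfold dMin
    rw [abs_sub_comm, min_comm, dist_comm]
  · rintro ⟨a, p⟩ ⟨b, q⟩ ⟨c, s⟩ ha hb hc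
    dsimp only [dMin] at *
    have htri := dist_triangle p q s
    have hpq : 0 ≤ dist p q := dist_nonneg
    have hqs : 0 ≤ dist q s := dist_nonneg
    by_cases h : min (f a) (f c) ≤ f b
    · have h1 : min (f a) (f c) ≤ min (f a) (f b) := le_min (min_le_left _ _) h
      have h2 : min (f a) (f c) ≤ min (f b) (f c) := le_min h (min_le_right _ _)
      have e1 := mul_le_mul_of_nonneg_left htri (hmin a c ha hc).le
      have e2 := mul_le_mul_of_nonneg_right h1 hpq
      have e3 := mul_le_mul_of_nonneg_right h2 hqs
      have e4 := abs_sub_le a b c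
      linarith
    · obtain ⟨h1, h2⟩ := lt_min_iff.mp (not_le.mp h)
      have k1 := key b a hb ha h1 p s
      have k2 := key b c hb hc h2 p s
      have l1 := hlt b a hb ha h1
      have l2 := hlt b c hb hc h2
      have m1 := mul_le_mul_of_nonneg_right (min_le_left (f a) (f c)) (dist_nonneg (x := p) (y := s))
      have m2 := mul_le_mul_of_nonneg_right (min_le_right (f a) (f c)) (dist_nonneg (x := p) (y := s))
      have e1 := mul_le_mul_of_nonneg_left htri (hfpos b hb).le
      rw [min_eq_right h1.le, min_eq_left h2.le, abs_of_pos (sub_pos.mpr l1),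
        abs_of_neg (sub_neg.mpr l2)]
      rcases abs_cases (a - c) with ⟨h3, _⟩ | ⟨h3, _⟩ <;> rw [h3] <;> linarith
  · intro x _ y₁ y₂
    simp [dMin]
  · intro x₀ _
    refine ⟨1, one_pos, 1, one_pos, ?_⟩
    intro x₁ _ x₂ _ y
    simp [dMin]
end

section
/- Let (Y, d_Y) be a metric space, M := (0,∞) × Y, and let M₀ := {0} ∪ M (the set M with one extra point adjoined, denoted 0) be equipped with a metric d_{M₀} : M₀ × M₀ → [0,∞) whose restriction to M satisfies: (i) there exists f : (0,∞) → (0,∞) with d_{M₀}((x, y₁), (x, y₂)) = f(x)·d_Y(y₁, y₂) for every x > 0 and y₁, y₂ ∈ Y, and (ii) for every x₀ > 0 there exist r > 0 and C > 0 with sup_{y∈Y} d_{M₀}((x₀, y), (x, y)) ≤ C for every x ∈ (x₀ − r, x₀ + r). If there exist at least two distinct points p₁ ≠ p₂ ∈ Y such that lim_{x→0⁺} d_{M₀}(0, (x, p_i)) = 0 for i = 1, 2, then diam Y < +∞. -/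
/-- Membership in `M₀ = {0} ∪ ((0,∞) × Y)`, where `M₀` is modeled as `Option (ℝ × Y)`:
`none` is the adjoined point `0`, and `some (x, y)` belongs to `M₀` iff `x > 0`. -/
def MemM0 {Y : Type*} (a : Option (ℝ × Y)) : Prop :=
  a.elim True fun p => 0 < p.1

theorem statement9 {Y : Type*} [MetricSpace Y]
    -- `D` is a distance function on `M₀ = {0} ∪ ((0,∞) × Y)`
    (D : Option (ℝ × Y) → Option (ℝ × Y) → ℝ)
    (hnonneg : ∀ a b, MemM0 a → MemM0 b → 0 ≤ D a b)
    (heq : ∀ a b, MemM0 a → MemM0 b → (D a b = 0 ↔ a = b))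
    (hsymm : ∀ a b, MemM0 a → MemM0 b → D a b = D b a)
    (htri : ∀ a b c, MemM0 a → MemM0 b → MemM0 c → D a c ≤ D a b + D b c)
    -- (i) fiber condition on `M = (0,∞) × Y`
    (f : ℝ → ℝ) (hf : ∀ x : ℝ, 0 < x → 0 < f x)
    (hfiber : ∀ x : ℝ, 0 < x → ∀ y₁ y₂ : Y,
      D (some (x, y₁)) (some (x, y₂)) = f x * dist y₁ y₂)
    -- (ii) uniform local bound
    (hii : ∀ x₀ : ℝ, 0 < x₀ → ∃ r > (0 : ℝ), ∃ C > (0 : ℝ), ∀ x : ℝ, 0 < x →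
      x ∈ Set.Ioo (x₀ - r) (x₀ + r) → ∀ y : Y, D (some (x₀, y)) (some (x, y)) ≤ C)
    -- two distinct points `p₁ ≠ p₂` with `D(0, (x, pᵢ)) → 0` as `x → 0⁺`
    (p₁ p₂ : Y) (hp : p₁ ≠ p₂)
    (hlim₁ : Filter.Tendsto (fun x : ℝ => D none (some (x, p₁)))
      (nhdsWithin 0 (Set.Ioi 0)) (nhds 0))
    (hlim₂ : Filter.Tendsto (fun x : ℝ => D none (some (x, p₂)))
      (nhdsWithin 0 (Set.Ioi 0)) (nhds 0)) :
    EMetric.diam (Set.univ : Set Y) ≠ ⊤ := by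
  intro htop
  have hm : ∀ x : ℝ, 0 < x → ∀ y : Y, MemM0 (some (x, y)) := fun x hx y => hx
  have hm0 : MemM0 (none : Option (ℝ × Y)) := trivial
  -- unboundedness of `Y`
  have hunb : ∀ K : ℝ, ∃ y₁ y₂ : Y, K < dist y₁ y₂ := by
    intro K
    by_contra! h
    have hb : Bornology.IsBounded (Set.univ : Set Y) :=
      Metric.isBounded_iff.2 ⟨K, fun a _ b _ => h a b⟩
    exact (Metric.isBounded_iff_ediam_ne_top.1 hb) htop
  have hloc : ∀ x₀ : ℝ, 0 < x₀ → ∀ᶠ x in nhds x₀, f x = f x₀ := by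
    intro x₀ hx₀
    obtain ⟨r, hr, C, hC, h⟩ := hii x₀ hx₀
    filter_upwards [Ioo_mem_nhds (show x₀ - r < x₀ by linarith) (show x₀ < x₀ + r by linarith),
      Ioi_mem_nhds hx₀] with x hx hx0
    have hx0' : 0 < x := hx0
    by_contra hne
    have hpos : 0 < |f x - f x₀| := abs_pos.2 (sub_ne_zero.2 hne)
    obtain ⟨y₁, y₂, hy⟩ := hunb (2 * C / |f x - f x₀|)
    rw [div_lt_iff₀ hpos] at hy
    have a1 := h x hx0' hx y₁
    have a2 := h x hx0' hx y₂
    have m1 := hm x hx0' y₁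
    have m2 := hm x hx0' y₂
    have n1 := hm x₀ hx₀ y₁
    have n2 := hm x₀ hx₀ y₂
    have s1 := hsymm _ _ m1 n1
    have s2 := hsymm _ _ m2 n2
    have t1 := htri _ _ _ m1 n1 m2
    have t2 := htri _ _ _ n1 n2 m2
    have t3 := htri _ _ _ n1 m1 n2
    have t4 := htri _ _ _ m1 m2 n2
    have e1 := hfiber x hx0' y₁ y₂
    have e2 := hfiber x₀ hx₀ y₁ y₂
    have : dist y₁ y₂ * |f x - f x₀| ≤ 2 * C := by
      rcases abs_cases (f x - f x₀) with ⟨h1, _⟩ | ⟨h1, _⟩ <;> rw [h1] <;> linarith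
    linarith
  have hconst : ∀ x : ℝ, 0 < x → f x = f 1 := by
    intro x hx
    have hd : ∀ z ∈ Set.Ioi (0 : ℝ), HasDerivAt f 0 z := fun z hz =>
      (hasDerivAt_const z (f z)).congr_of_eventuallyEq (hloc z hz)
    exact isOpen_Ioi.is_const_of_deriv_eq_zero isPreconnected_Ioi
      (fun z hz => (hd z hz).differentiableAt.differentiableWithinAt)
      (fun z hz => (hd z hz).deriv) hx (Set.mem_Ioi.2 one_pos)
  have hlim := hlim₁.add hlim₂
  have hle : f 1 * dist p₁ p₂ ≤ 0 + 0 := by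
    refine ge_of_tendsto hlim ?_
    filter_upwards [self_mem_nhdsWithin] with x hx
    have hx' : 0 < x := hx
    have e := hfiber x hx' p₁ p₂
    have t := htri _ _ _ (hm x hx' p₁) hm0 (hm x hx' p₂)
    have s := hsymm _ _ (hm x hx' p₁) hm0
    rw [← hconst x hx']
    linarith
  have := mul_pos (hf 1 one_pos) (dist_pos.2 hp)
  linarith
end

section
/- Let (Y, d_Y) be a metric space with diam Y < +∞ and let f : (0,∞) → (0,∞) be a Lipschitz, increasing function such that sup_{x₁≠x₂} |f(x₁) − f(x₂)|/|x₁ − x₂| ≤ 1/diam Y and lim_{x→0⁺} f(x) = 0. Define d_{M₀} on M₀ := {0} ∪ ((0,∞) × Y) by d_{M₀}((x₁, y₁), (x₂, y₂)) := |x₁ − x₂| + min{f(x₁), f(x₂)}·d_Y(y₁, y₂) for points of (0,∞) × Y, d_{M₀}(0, (x, y)) = d_{M₀}((x, y), 0) := x, and d_{M₀}(0, 0) := 0. Then d_{M₀} is a metric on M₀. -/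
theorem statement11 {Y : Type*} [MetricSpace Y]
    -- `diam Y < +∞`
    (hYbdd : Bornology.IsBounded (Set.univ : Set Y))
    -- `f : (0,∞) → (0,∞)` is Lipschitz, increasing, with Lipschitz constant at most
    -- `1 / diam Y` (written multiplicatively), and `f(x) → 0` as `x → 0⁺`
    (f : ℝ → ℝ) (hfpos : ∀ x : ℝ, 0 < x → 0 < f x)
    (hfmono : ∀ x₁ x₂ : ℝ, 0 < x₁ → x₁ < x₂ → f x₁ < f x₂)
    (hfLip : ∃ L : ℝ, ∀ x₁ x₂ : ℝ, 0 < x₁ → 0 < x₂ → |f x₁ - f x₂| ≤ L * |x₁ - x₂|)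
    (hfdiam : ∀ x₁ x₂ : ℝ, 0 < x₁ → 0 < x₂ →
      |f x₁ - f x₂| * Metric.diam (Set.univ : Set Y) ≤ |x₁ - x₂|)
    (hf0 : Filter.Tendsto f (nhdsWithin 0 (Set.Ioi 0)) (nhds 0))
    -- `D` is the function `d_{M₀}` of the statement on `M₀ = {0} ∪ ((0,∞) × Y)`
    (D : Option (ℝ × Y) → Option (ℝ × Y) → ℝ)
    (hDm : ∀ x₁ x₂ : ℝ, 0 < x₁ → 0 < x₂ → ∀ y₁ y₂ : Y,
      D (some (x₁, y₁)) (some (x₂, y₂)) = |x₁ - x₂| + min (f x₁) (f x₂) * dist y₁ y₂)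
    (hD0r : ∀ x : ℝ, 0 < x → ∀ y : Y, D none (some (x, y)) = x)
    (hD0l : ∀ x : ℝ, 0 < x → ∀ y : Y, D (some (x, y)) none = x)
    (hD00 : D none none = 0) :
    -- `D` is a distance function on `M₀`
    (∀ a b, MemM0 a → MemM0 b → 0 ≤ D a b) ∧
    (∀ a b, MemM0 a → MemM0 b → (D a b = 0 ↔ a = b)) ∧
    (∀ a b, MemM0 a → MemM0 b → D a b = D b a) ∧
    (∀ a b c, MemM0 a → MemM0 b → MemM0 c → D a c ≤ D a b + D b c) := by
  have hdd : ∀ y y' : Y, dist y y' ≤ Metric.diam (Set.univ : Set Y) := fun y y' =>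
    Metric.dist_le_diam_of_mem hYbdd (Set.mem_univ _) (Set.mem_univ _)
  have hA : ∀ x₁ x₂ : ℝ, 0 < x₁ → 0 < x₂ → ∀ y y' : Y,
      (f x₁ - f x₂) * dist y y' ≤ |x₁ - x₂| := by
    intro x₁ x₂ h₁ h₂ y y'
    calc (f x₁ - f x₂) * dist y y' ≤ |f x₁ - f x₂| * dist y y' :=
          mul_le_mul_of_nonneg_right (le_abs_self _) dist_nonneg
      _ ≤ |f x₁ - f x₂| * Metric.diam (Set.univ : Set Y) :=
          mul_le_mul_of_nonneg_left (hdd y y') (abs_nonneg _)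
      _ ≤ _ := hfdiam _ _ h₁ h₂
  have hB : ∀ x : ℝ, 0 < x → ∀ y y' : Y, f x * dist y y' ≤ x := by
    intro x hx y y'
    have t1 : Filter.Tendsto (fun t => (f x - f t) * dist y y')
        (nhdsWithin 0 (Set.Ioi 0)) (nhds ((f x - 0) * dist y y')) :=
      (tendsto_const_nhds.sub hf0).mul tendsto_const_nhds
    have t2 : Filter.Tendsto (fun t : ℝ => |x - t|)
        (nhdsWithin 0 (Set.Ioi 0)) (nhds |x - 0|) := by
      have : Continuous (fun t : ℝ => |x - t|) := by fun_prop
      exact (this.tendsto 0).mono_left nhdsWithin_le_nhds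
    have := le_of_tendsto_of_tendsto t1 t2 (by
      filter_upwards [self_mem_nhdsWithin] with t ht
      exact hA x t hx ht y y')
    simpa [abs_of_pos hx] using this
  have hmle : ∀ x₁ x₂ : ℝ, 0 < x₁ → x₁ ≤ x₂ → f x₁ ≤ f x₂ := by
    intro x₁ x₂ h₁ h
    rcases h.lt_or_eq with h | h
    · exact (hfmono _ _ h₁ h).le
    · rw [h]
  have hmn : ∀ x₁ x₂ : ℝ, 0 < x₁ → 0 < x₂ → ∀ y y' : Y,
      0 ≤ min (f x₁) (f x₂) * dist y y' := fun x₁ x₂ h₁ h₂ y y' =>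
    mul_nonneg (le_min (hfpos _ h₁).le (hfpos _ h₂).le) dist_nonneg
  have hsymm : ∀ a b, MemM0 a → MemM0 b → D a b = D b a := by
    rintro (_ | ⟨x₁, y₁⟩) (_ | ⟨x₂, y₂⟩) ha hb
    · rfl
    · rw [hD0r _ hb, hD0l _ hb]
    · rw [hD0r _ ha, hD0l _ ha]
    · rw [hDm _ _ ha hb, hDm _ _ hb ha, abs_sub_comm, min_comm, dist_comm]
  refine ⟨?_, ?_, hsymm, ?_⟩
  · rintro (_ | ⟨x₁, y₁⟩) (_ | ⟨x₂, y₂⟩) ha hb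
    · rw [hD00]
    · rw [hD0r _ hb]; exact le_of_lt hb
    · rw [hD0l _ ha]; exact le_of_lt ha
    · rw [hDm _ _ ha hb]; exact add_nonneg (abs_nonneg _) (hmn _ _ ha hb _ _)
  · rintro (_ | ⟨x₁, y₁⟩) (_ | ⟨x₂, y₂⟩) ha hb
    · simp [hD00]
    · rw [hD0r _ hb]; simpa using ne_of_gt hb
    · rw [hD0l _ ha]; simpa using ne_of_gt ha
    · rw [hDm _ _ ha hb]
      constructor
      · intro h
        have h1 := hmn _ _ ha hb y₁ y₂
        have h2 := abs_nonneg (x₁ - x₂)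
        have h3 : |x₁ - x₂| = 0 := by linarith
        have h4 : min (f x₁) (f x₂) * dist y₁ y₂ = 0 := by linarith
        have h5 : 0 < min (f x₁) (f x₂) := lt_min (hfpos _ ha) (hfpos _ hb)
        have h6 : dist y₁ y₂ = 0 := by
          rcases mul_eq_zero.1 h4 with h | h
          · exact absurd h h5.ne'
          · exact h
        rw [sub_eq_zero.1 (abs_eq_zero.1 h3), dist_eq_zero.1 h6]
      · intro h
        simp only [Option.some.injEq, Prod.mk.injEq] at h
        simp [h.1, h.2]
  · have key : ∀ x₁ x₂ x₃ : ℝ, 0 < x₁ → 0 < x₂ → 0 < x₃ → x₁ ≤ x₃ → ∀ y₁ y₂ y₃ : Y,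
        |x₁ - x₃| + min (f x₁) (f x₃) * dist y₁ y₃ ≤
        (|x₁ - x₂| + min (f x₁) (f x₂) * dist y₁ y₂) +
        (|x₂ - x₃| + min (f x₂) (f x₃) * dist y₂ y₃) := by
      intro x₁ x₂ x₃ h₁ h₂ h₃ h y₁ y₂ y₃
      have ht := dist_triangle y₁ y₂ y₃
      rw [min_eq_left (hmle _ _ h₁ h)]
      rcases le_total x₁ x₂ with h' | h'
      · have e := hmle _ _ h₁ h'
        rw [min_eq_left e]
        have e2 : f x₁ * dist y₂ y₃ ≤ min (f x₂) (f x₃) * dist y₂ y₃ :=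
          mul_le_mul_of_nonneg_right (le_min e (hmle _ _ h₁ h)) dist_nonneg
        have e3 := mul_le_mul_of_nonneg_left ht (hfpos _ h₁).le
        have e4 := abs_sub_le x₁ x₂ x₃
        linarith
      · rw [min_eq_right (hmle _ _ h₂ h'), min_eq_left (hmle _ _ h₂ (h'.trans h))]
        have e3 := mul_le_mul_of_nonneg_left ht (hfpos _ h₂).le
        have e5 := hA x₁ x₂ h₁ h₂ y₁ y₃
        rw [abs_of_nonneg (sub_nonneg.2 h')] at e5 ⊢
        rw [abs_of_nonpos (by linarith : x₁ - x₃ ≤ 0),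
          abs_of_nonpos (by linarith : x₂ - x₃ ≤ 0)]
        linarith
    rintro (_ | ⟨x₁, y₁⟩) (_ | ⟨x₂, y₂⟩) (_ | ⟨x₃, y₃⟩) ha hb hc
    · simp [hD00]
    · simp [hD00]
    · rw [hD00, hD0r _ hb, hD0l _ hb]
      have hb' : 0 < x₂ := hb
      linarith
    · rw [hD0r _ hb, hD0r _ hc, hDm _ _ hb hc]
      have := hmn _ _ hb hc y₂ y₃
      have := neg_abs_le (x₂ - x₃)
      linarith
    · simp [hD00]
    · rw [hD0r _ hc, hD0l _ ha, hDm _ _ ha hc]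
      have ha' : 0 < x₁ := ha
      have hc' : 0 < x₃ := hc
      rcases le_total x₁ x₃ with h | h
      · have := hB _ ha' y₁ y₃
        rw [min_eq_left (hmle _ _ ha' h), abs_of_nonpos (by linarith)]
        linarith
      · have := hB _ hc' y₁ y₃
        rw [min_eq_right (hmle _ _ hc' h), abs_of_nonneg (by linarith)]
        linarith
    · rw [hD0l _ ha, hD0l _ hb, hDm _ _ ha hb]
      have := hmn _ _ ha hb y₁ y₂
      have := le_abs_self (x₁ - x₂)
      linarith
    · rcases le_total x₁ x₃ with h | h
      · rw [hDm _ _ ha hc, hDm _ _ ha hb, hDm _ _ hb hc]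
        exact key _ _ _ ha hb hc h _ _ _
      · rw [hsymm _ _ ha hc, hsymm _ _ ha hb, hsymm _ _ hb hc, add_comm,
          hDm _ _ hc ha, hDm _ _ hb ha, hDm _ _ hc hb]
        exact key _ _ _ hc hb ha h _ _ _
end

section
/- Let p ∈ [1,∞). There exists no metric d on M_c(ℝ^n) such that d(μ₁, μ₂) = λ₀·W_p(μ₁/m₀, μ₂/m₀) whenever |μ₁| = |μ₂| = m₀, for some fixed m₀ > 0 and λ₀ > 0, and which is invariant with respect to the isometries of ℝ^n, i.e. d(T#μ₁, T#μ₂) = d(μ₁, μ₂) for every isometry T : ℝ^n → ℝ^n and every μ₁, μ₂ ∈ M_c(ℝ^n). (Here M_c(ℝ^n) includes the zero measure.) -/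
open MeasureTheory ENNReal

/-- `μ ∈ M_c(ℝⁿ)`: compactly supported, with finite mass (possibly the zero measure). -/
def IsMc {n : ℕ} (μ : Measure (EuclideanSpace ℝ (Fin n))) : Prop :=
  CompactSupp μ ∧ μ Set.univ ≠ ⊤

theorem statement12 (n : ℕ) (hn : 0 < n) (p : ℝ) (hp : 1 ≤ p) :
    ¬ ∃ (d : Measure (EuclideanSpace ℝ (Fin n)) → Measure (EuclideanSpace ℝ (Fin n)) → ℝ)
        (m₀ lam₀ : ℝ), 0 < m₀ ∧ 0 < lam₀ ∧
      -- `d` is a distance function on `M_c(ℝⁿ)` (including the zero measure)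
      (∀ μ ν, IsMc μ → IsMc ν → 0 ≤ d μ ν) ∧
      (∀ μ ν, IsMc μ → IsMc ν → (d μ ν = 0 ↔ μ = ν)) ∧
      (∀ μ ν, IsMc μ → IsMc ν → d μ ν = d ν μ) ∧
      (∀ μ ν ρ, IsMc μ → IsMc ν → IsMc ρ → d μ ρ ≤ d μ ν + d ν ρ) ∧
      -- `d(μ₁, μ₂) = λ₀ W_p(μ₁/m₀, μ₂/m₀)` whenever `|μ₁| = |μ₂| = m₀`
      (∀ μ₁ μ₂, IsMc μ₁ → IsMc μ₂ →
        μ₁ Set.univ = ENNReal.ofReal m₀ → μ₂ Set.univ = ENNReal.ofReal m₀ →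
        d μ₁ μ₂ = lam₀ * Wp n p ((ENNReal.ofReal m₀)⁻¹ • μ₁) ((ENNReal.ofReal m₀)⁻¹ • μ₂)) ∧
      -- `d` is invariant with respect to the isometries of `ℝⁿ`
      (∀ T : EuclideanSpace ℝ (Fin n) → EuclideanSpace ℝ (Fin n), Isometry T →
        ∀ μ₁ μ₂, IsMc μ₁ → IsMc μ₂ → d (μ₁.map T) (μ₂.map T) = d μ₁ μ₂) := by
  rintro ⟨d, m, l, hm, hl, -, -, hsymm, htri, hW, hT⟩
  have hM : ∀ x : EuclideanSpace ℝ (Fin n), IsMc (ENNReal.ofReal m • Measure.dirac x) := by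
    intro x
    refine ⟨⟨{x}, isCompact_singleton, ?_⟩, ?_⟩
    · simp
    · simp
  have h0 : IsMc (0 : Measure (EuclideanSpace ℝ (Fin n))) :=
    ⟨⟨∅, isCompact_empty, by simp⟩, by simp⟩
  have hd : ∀ x y : EuclideanSpace ℝ (Fin n),
      d (ENNReal.ofReal m • Measure.dirac x) (ENNReal.ofReal m • Measure.dirac y)
        = l * dist x y := by
    intro x y
    rw [hW _ _ (hM x) (hM y) (by simp) (by simp), smul_smul, smul_smul,
      ENNReal.inv_mul_cancel (by simpa using hm) ENNReal.ofReal_ne_top, one_smul, one_smul,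
      Wp_dirac n p hp]
  have hc : ∀ x : EuclideanSpace ℝ (Fin n),
      d (ENNReal.ofReal m • Measure.dirac x) 0
        = d (ENNReal.ofReal m • Measure.dirac (0 : EuclideanSpace ℝ (Fin n))) 0 := by
    intro x
    have hi : Isometry (fun z : EuclideanSpace ℝ (Fin n) => z + x) :=
      isometry_add_right x
    have := hT _ hi _ _ (hM 0) h0
    rw [Measure.map_smul, Measure.map_dirac' hi.continuous.measurable, Measure.map_zero,
      zero_add] at this
    exact this
  set C := d (ENNReal.ofReal m • Measure.dirac (0 : EuclideanSpace ℝ (Fin n))) 0 with hC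
  have hb : ∀ x : EuclideanSpace ℝ (Fin n), l * ‖x‖ ≤ 2 * C := by
    intro x
    have h1 := htri _ _ _ (hM x) h0 (hM 0)
    rw [hd, dist_zero_right, hc, hsymm _ _ h0 (hM 0)] at h1
    linarith
  have hx := hb (EuclideanSpace.single ⟨0, hn⟩ ((2 * |C| + 1) / l))
  have hpos : 0 ≤ (2 * |C| + 1) / l := by positivity
  rw [EuclideanSpace.norm_single, Real.norm_of_nonneg hpos, mul_div_cancel₀ _ hl.ne'] at hx
  linarith [le_abs_self C]
end

section
/- Let p ∈ [1,∞), λ > 0, and q ∈ [1,∞). Define, for μ₁, μ₂ ∈ M*_c(ℝ^n), d_{M,q}(μ₁, μ₂) := ( ||μ₁| − |μ₂||^q + λ^q · W_p(μ₁/|μ₁|, μ₂/|μ₂|)^q )^{1/q}, and d_{M,∞}(μ₁, μ₂) := max{ ||μ₁| − |μ₂||, λ·W_p(μ₁/|μ₁|, μ₂/|μ₂|) }. Then, for every q ∈ [1,∞], d_{M,q} is a metric on M*_c(ℝ^n) satisfying d_{M,q}(m·μ₁, m·μ₂) = λ·W_p(μ₁, μ₂) for all m > 0 and μ₁, μ₂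 ∈ P_c(ℝ^n), together with sup_{μ ∈ P_c(ℝ^n)} d_{M,q}(m₀·μ, m·μ) = |m₀ − m| for every m, m₀ > 0. -/
open MeasureTheory ENNReal

/-- The total mass `|μ|` of a measure, as a real number. -/
noncomputable def massOf {n : ℕ} (μ : Measure (EuclideanSpace ℝ (Fin n))) : ℝ :=
  (μ Set.univ).toReal

/-- The normalization `μ / |μ|` of a measure. -/
noncomputable def nrmOf {n : ℕ} (μ : Measure (EuclideanSpace ℝ (Fin n))) :
    Measure (EuclideanSpace ℝ (Fin n)) :=
  (μ Set.univ)⁻¹ • μ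

/-- The product distance
`d_{M,q}(μ₁,μ₂) = (||μ₁| - |μ₂||^q + λ^q W_p(μ₁/|μ₁|, μ₂/|μ₂|)^q)^{1/q}`. -/
noncomputable def dMq (n : ℕ) (p q l : ℝ)
    (μ₁ μ₂ : Measure (EuclideanSpace ℝ (Fin n))) : ℝ :=
  (|massOf μ₁ - massOf μ₂| ^ q + l ^ q * Wp n p (nrmOf μ₁) (nrmOf μ₂) ^ q) ^ (1 / q)

/-- The product distance
`d_{M,∞}(μ₁,μ₂) = max{||μ₁| - |μ₂||, λ W_p(μ₁/|μ₁|, μ₂/|μ₂|)}`. -/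
noncomputable def dMinfty (n : ℕ) (p l : ℝ)
    (μ₁ μ₂ : Measure (EuclideanSpace ℝ (Fin n))) : ℝ :=
  max |massOf μ₁ - massOf μ₂| (l * Wp n p (nrmOf μ₁) (nrmOf μ₂))


section Helpers

open Filter Topology

variable {n : ℕ}

/-- The cost of a plan. -/
noncomputable def planCost (n : ℕ) (p : ℝ)
    (π : Measure (EuclideanSpace ℝ (Fin n) × EuclideanSpace ℝ (Fin n))) : ℝ≥0∞ :=
  ∫⁻ q, edist q.1 q.2 ^ p ∂π

/-- The couplings of two measures. -/
def Cpl {n : ℕ} (μ ν : Measure (EuclideanSpace ℝ (Fin n))) : Type :=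
  {π : Measure (EuclideanSpace ℝ (Fin n) × EuclideanSpace ℝ (Fin n)) //
    π.map Prod.fst = μ ∧ π.map Prod.snd = ν}

/-- Extended-valued Wasserstein distance. -/
noncomputable def EW (n : ℕ) (p : ℝ) (μ ν : Measure (EuclideanSpace ℝ (Fin n))) : ℝ≥0∞ :=
  ⨅ π : Cpl μ ν, planCost n p π.1 ^ (1 / p)

lemma Wp_eq (p : ℝ) (hp : 1 ≤ p) (μ ν : Measure (EuclideanSpace ℝ (Fin n))) :
    Wp n p μ ν = (EW n p μ ν).toReal := by
  have hp0 : 0 < 1 / p := by positivity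
  unfold Wp EW
  congr 1
  have h : {c : ℝ≥0∞ | ∃ π : Measure (EuclideanSpace ℝ (Fin n) × EuclideanSpace ℝ (Fin n)),
      π.map Prod.fst = μ ∧ π.map Prod.snd = ν ∧
      c = ∫⁻ q, edist q.1 q.2 ^ p ∂π} = Set.range (fun π : Cpl μ ν => planCost n p π.1) := by
    ext c
    constructor
    · rintro ⟨π, h1, h2, h3⟩
      exact ⟨⟨π, h1, h2⟩, h3.symm⟩
    · rintro ⟨⟨π, h1, h2⟩, h3⟩
      exact ⟨π, h1, h2, h3.symm⟩
  rw [h, sInf_range]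
  exact (ENNReal.orderIsoRpow (1 / p) hp0).map_iInf _

lemma cost_meas (p : ℝ) : Measurable
    (fun q : EuclideanSpace ℝ (Fin n) × EuclideanSpace ℝ (Fin n) => edist q.1 q.2 ^ p) :=
  (measurable_fst.edist measurable_snd).pow_const p

lemma EW_self (p : ℝ) (hp : 1 ≤ p) (μ : Measure (EuclideanSpace ℝ (Fin n))) :
    EW n p μ μ = 0 := by
  have hp0 : 0 < p := by linarith
  have hm : Measurable (fun x : EuclideanSpace ℝ (Fin n) => (x, x)) := by fun_prop
  refine le_antisymm ?_ zero_le
  refine (iInf_le _ (⟨μ.map (fun x => (x, x)), ?_, ?_⟩ : Cpl μ μ)).trans ?_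
  · rw [Measure.map_map measurable_fst hm]
    exact Measure.map_id
  · rw [Measure.map_map measurable_snd hm]
    exact Measure.map_id
  · unfold planCost
    simp only
    rw [lintegral_map (cost_meas p) hm]
    simp [hp0]

lemma EW_symm_le (p : ℝ) (μ ν : Measure (EuclideanSpace ℝ (Fin n))) :
    EW n p μ ν ≤ EW n p ν μ := by
  refine le_iInf fun π => ?_
  obtain ⟨π, h1, h2⟩ := π
  refine (iInf_le _ (⟨π.map Prod.swap, ?_, ?_⟩ : Cpl μ ν)).trans ?_
  · rw [Measure.map_map measurable_fst measurable_swap]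
    exact h2
  · rw [Measure.map_map measurable_snd measurable_swap]
    exact h1
  · unfold planCost
    simp only
    rw [lintegral_map (cost_meas p) measurable_swap]
    simp [edist_comm]

lemma EW_symm (p : ℝ) (μ ν : Measure (EuclideanSpace ℝ (Fin n))) :
    EW n p μ ν = EW n p ν μ := le_antisymm (EW_symm_le p μ ν) (EW_symm_le p ν μ)

lemma Cpl.finite {μ ν : Measure (EuclideanSpace ℝ (Fin n))} [IsFiniteMeasure μ]
    (π : Cpl μ ν) : IsFiniteMeasure π.1 := by
  constructor
  obtain ⟨π, h, -⟩ := π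
  simp only
  have : π Set.univ = μ Set.univ := by
    rw [← h, Measure.map_apply measurable_fst MeasurableSet.univ, Set.preimage_univ]
  rw [this]
  exact measure_lt_top _ _

lemma EW_triangle (p : ℝ) (hp : 1 ≤ p) (μ ν ρ : Measure (EuclideanSpace ℝ (Fin n)))
    [IsFiniteMeasure μ] [IsFiniteMeasure ν] :
    EW n p μ ρ ≤ EW n p μ ν + EW n p ν ρ := by
  refine ENNReal.le_iInf_add_iInf fun π₁ π₂ => ?_
  have := π₁.finite
  have := π₂.finite
  obtain ⟨π₁, h1, h2⟩ := π₁
  obtain ⟨π₂, h3, h4⟩ := π₂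
  simp only at *
  let κ := π₂.condKernel
  let κ' : ProbabilityTheory.Kernel (EuclideanSpace ℝ (Fin n) × EuclideanSpace ℝ (Fin n))
    (EuclideanSpace ℝ (Fin n)) := κ.comap (Prod.snd : EuclideanSpace ℝ (Fin n) × EuclideanSpace ℝ (Fin n) → _)
    measurable_snd
  let γ := π₁.compProd κ'
  have hA : γ.map Prod.fst = π₁ := Measure.fst_compProd π₁ κ'
  have hm : Measurable (fun x : (EuclideanSpace ℝ (Fin n) × EuclideanSpace ℝ (Fin n)) ×
    EuclideanSpace ℝ (Fin n) => (x.1.2, x.2)) := by fun_prop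
  have hm' : Measurable (fun x : (EuclideanSpace ℝ (Fin n) × EuclideanSpace ℝ (Fin n)) ×
    EuclideanSpace ℝ (Fin n) => (x.1.1, x.2)) := by fun_prop
  have hB : γ.map (fun x => (x.1.2, x.2)) = π₂ := by
    refine Measure.ext_of_lintegral _ fun f hf => ?_
    rw [lintegral_map hf hm]
    refine (Measure.lintegral_compProd (μ := π₁) (κ := κ') (hf.comp hm)).trans ?_
    conv_rhs => rw [← π₂.disintegrate π₂.condKernel]
    rw [Measure.lintegral_compProd hf, Measure.fst, h3, ← h2,
      lintegral_map hf.lintegral_kernel_prod_right' measurable_snd]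
    rfl
  refine (iInf_le _ (⟨γ.map (fun x => (x.1.1, x.2)), ?_, ?_⟩ : Cpl μ ρ)).trans ?_
  · rw [Measure.map_map measurable_fst hm', ← h1, ← hA,
      Measure.map_map measurable_fst measurable_fst]
    rfl
  · rw [Measure.map_map measurable_snd hm', ← h4, ← hB, Measure.map_map measurable_snd hm]
    rfl
  · unfold planCost
    simp only
    conv_rhs => rw [← hB]; arg 1; rw [← hA]
    rw [lintegral_map (cost_meas p) hm', lintegral_map (cost_meas p) hm,
      lintegral_map (cost_meas p) measurable_fst]
    refine le_trans ?_ (ENNReal.lintegral_Lp_add_le (p := p) (μ := γ)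
      (f := fun x => edist x.1.1 x.1.2) (g := fun x => edist x.1.2 x.2) ?_ ?_ hp)
    · refine ENNReal.rpow_le_rpow ?_ (by positivity)
      refine lintegral_mono fun x => ?_
      exact ENNReal.rpow_le_rpow (edist_triangle _ _ _) (by positivity)
    · exact (Measurable.edist (by fun_prop) (by fun_prop)).aemeasurable
    · exact (Measurable.edist (by fun_prop) (by fun_prop)).aemeasurable

lemma EW_ne_top (p : ℝ) (hp : 1 ≤ p) {μ ν : Measure (EuclideanSpace ℝ (Fin n))}
    (hμ : IsPc μ) (hν : IsPc ν) : EW n p μ ν ≠ ⊤ := by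
  have : IsProbabilityMeasure μ := ⟨hμ.2⟩
  have : IsProbabilityMeasure ν := ⟨hν.2⟩
  obtain ⟨K, hK, hK0⟩ := hμ.1
  obtain ⟨L, hL, hL0⟩ := hν.1
  have hp0 : 0 ≤ p := by linarith
  refine ne_top_of_le_ne_top ?_ (iInf_le _ (⟨μ.prod ν, ?_, ?_⟩ : Cpl μ ν))
  · refine ENNReal.rpow_ne_top_of_nonneg (by positivity) ?_
    unfold planCost
    simp only
    have hd : Metric.ediam (K ∪ L) ≠ ⊤ := (hK.union hL).isBounded.ediam_ne_top
    refine ne_top_of_le_ne_top (b := ∫⁻ _, (Metric.ediam (K ∪ L)) ^ p ∂(μ.prod ν)) ?_ ?_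
    · simpa using ENNReal.rpow_ne_top_of_nonneg hp0 hd
    · refine lintegral_mono_ae ?_
      have hk : ∀ᵐ x ∂μ, x ∈ K := by
        rw [ae_iff]; exact hK0
      have hl : ∀ᵐ x ∂ν, x ∈ L := by
        rw [ae_iff]; exact hL0
      have hk' := Measure.quasiMeasurePreserving_fst.ae (μa := μ.prod ν) hk
      have hl' := Measure.quasiMeasurePreserving_snd.ae (μa := μ.prod ν) hl
      filter_upwards [hk', hl'] with x hx hy
      exact ENNReal.rpow_le_rpow (Metric.edist_le_ediam_of_mem (Or.inl hx) (Or.inr hy)) hp0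
  · exact (Measure.fst_prod (μ := μ) (ν := ν))
  · exact (Measure.snd_prod (μ := μ) (ν := ν))

lemma closed_le_of_EW (p : ℝ) (hp : 1 ≤ p) {μ ν : Measure (EuclideanSpace ℝ (Fin n))}
    [IsFiniteMeasure ν] (h : EW n p μ ν = 0) (F : Set (EuclideanSpace ℝ (Fin n)))
    (hF : IsClosed F) : μ F ≤ ν F := by
  have hp0 : 0 < p := by linarith
  have ht := tendsto_measure_thickening_of_isClosed (μ := ν) (s := F)
    ⟨1, one_pos, measure_ne_top _ _⟩ hF
  refine ge_of_tendsto ht ?_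
  filter_upwards [self_mem_nhdsWithin] with δ hδ
  have hδ : 0 < δ := hδ
  have hδe : (ENNReal.ofReal δ) ^ p ≠ 0 := by
    simp [ENNReal.rpow_eq_zero_iff, hδ]
  have hδt : (ENNReal.ofReal δ) ^ p ≠ ⊤ :=
    ENNReal.rpow_ne_top_of_nonneg hp0.le ENNReal.ofReal_ne_top
  refine ENNReal.le_of_forall_pos_le_add fun ε hε _ => ?_
  have hε' : (0 : ℝ≥0∞) < ε := by exact_mod_cast hε
  set c : ℝ≥0∞ := (ε * (ENNReal.ofReal δ) ^ p) ^ (1 / p) with hc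
  have hcpos : 0 < c := by
    refine ENNReal.rpow_pos (ENNReal.mul_pos hε'.ne' hδe) (ENNReal.mul_ne_top (by simp) hδt)
  rw [← h] at hcpos
  obtain ⟨π, hπ⟩ := iInf_lt_iff.1 hcpos
  have hcost : planCost n p π.1 < ε * (ENNReal.ofReal δ) ^ p :=
    (ENNReal.rpow_lt_rpow_iff (by positivity)).1 hπ
  obtain ⟨π, h1, h2⟩ := π
  simp only at hcost
  have hmk := meas_ge_le_lintegral_div (μ := π) (cost_meas (n := n) p).aemeasurable hδe hδt
  have hmk2 : π {x | ENNReal.ofReal δ ^ p ≤ edist x.1 x.2 ^ p} ≤ ε :=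
    hmk.trans (ENNReal.div_le_of_le_mul hcost.le)
  have hT : MeasurableSet (Metric.thickening δ F) := Metric.isOpen_thickening.measurableSet
  rw [← h1, ← h2, Measure.map_apply measurable_fst hF.measurableSet,
    Measure.map_apply measurable_snd hT]
  refine le_trans (measure_mono ?_) ((measure_union_le _ _).trans (add_le_add le_rfl hmk2))
  rintro ⟨x, y⟩ hx
  by_cases hxy : edist x y < ENNReal.ofReal δ
  · left
    rw [Set.mem_preimage, Metric.mem_thickening_iff]
    refine ⟨x, hx, ?_⟩
    rw [edist_dist, ENNReal.ofReal_lt_ofReal_iff hδ] at hxy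
    rwa [dist_comm]
  · right
    exact ENNReal.rpow_le_rpow (not_lt.1 hxy) hp0.le

lemma eq_of_EW (p : ℝ) (hp : 1 ≤ p) {μ ν : Measure (EuclideanSpace ℝ (Fin n))}
    (hμ : IsPc μ) (hν : IsPc ν) (h : EW n p μ ν = 0) : μ = ν := by
  have : IsProbabilityMeasure μ := ⟨hμ.2⟩
  have : IsProbabilityMeasure ν := ⟨hν.2⟩
  refine ext_of_generate_finite _ ?_ isPiSystem_isClosed (fun A hA => ?_) (by simp)
  · rw [BorelSpace.measurable_eq (α := EuclideanSpace ℝ (Fin n)), borel_eq_generateFrom_isClosed]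
  · exact le_antisymm (closed_le_of_EW p hp h A hA)
      (closed_le_of_EW p hp ((EW_symm p ν μ).trans h) A hA)

lemma Wp_nonneg (p : ℝ) (μ ν : Measure (EuclideanSpace ℝ (Fin n))) : 0 ≤ Wp n p μ ν :=
  ENNReal.toReal_nonneg

lemma Wp_self (p : ℝ) (hp : 1 ≤ p) (μ : Measure (EuclideanSpace ℝ (Fin n))) :
    Wp n p μ μ = 0 := by rw [Wp_eq p hp, EW_self p hp]; rfl

lemma Wp_symm (p : ℝ) (hp : 1 ≤ p) (μ ν : Measure (EuclideanSpace ℝ (Fin n))) :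
    Wp n p μ ν = Wp n p ν μ := by rw [Wp_eq p hp, Wp_eq p hp, EW_symm]

lemma Wp_triangle (p : ℝ) (hp : 1 ≤ p) {μ ν ρ : Measure (EuclideanSpace ℝ (Fin n))}
    (hμ : IsPc μ) (hν : IsPc ν) (hρ : IsPc ρ) : Wp n p μ ρ ≤ Wp n p μ ν + Wp n p ν ρ := by
  have : IsProbabilityMeasure μ := ⟨hμ.2⟩
  have : IsProbabilityMeasure ν := ⟨hν.2⟩
  rw [Wp_eq p hp, Wp_eq p hp, Wp_eq p hp,
    ← ENNReal.toReal_add (EW_ne_top p hp hμ hν) (EW_ne_top p hp hν hρ)]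
  exact ENNReal.toReal_mono (ENNReal.add_ne_top.2 ⟨EW_ne_top p hp hμ hν, EW_ne_top p hp hν hρ⟩)
    (EW_triangle p hp μ ν ρ)

lemma eq_of_Wp (p : ℝ) (hp : 1 ≤ p) {μ ν : Measure (EuclideanSpace ℝ (Fin n))}
    (hμ : IsPc μ) (hν : IsPc ν) (h : Wp n p μ ν = 0) : μ = ν := by
  rw [Wp_eq p hp, ENNReal.toReal_eq_zero_iff] at h
  exact eq_of_EW p hp hμ hν (h.resolve_right (EW_ne_top p hp hμ hν))

lemma nrm_pc {μ : Measure (EuclideanSpace ℝ (Fin n))} (hμ : IsMcStar μ) : IsPc (nrmOf μ) := by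
  obtain ⟨⟨K, hK, hK0⟩, h0, ht⟩ := hμ
  refine ⟨⟨K, hK, ?_⟩, ?_⟩
  · simp [nrmOf, hK0]
  · simp [nrmOf, ENNReal.inv_mul_cancel h0 ht]

lemma eq_of_mass_nrm {μ ν : Measure (EuclideanSpace ℝ (Fin n))} (hμ : IsMcStar μ)
    (hν : IsMcStar ν) (h1 : massOf μ = massOf ν) (h2 : nrmOf μ = nrmOf ν) : μ = ν := by
  have h3 : μ Set.univ = ν Set.univ := (ENNReal.toReal_eq_toReal_iff' hμ.2.2 hν.2.2).1 h1
  have key : ∀ ρ : Measure (EuclideanSpace ℝ (Fin n)), IsMcStar ρ →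
      ρ Set.univ • nrmOf ρ = ρ := by
    intro ρ hρ
    rw [nrmOf, smul_smul, ENNReal.mul_inv_cancel hρ.2.1 hρ.2.2, one_smul]
  rw [← key μ hμ, ← key ν hν, h2, h3]

lemma nrm_smul {m : ℝ} (hm : 0 < m) {μ : Measure (EuclideanSpace ℝ (Fin n))} (hμ : IsPc μ) :
    nrmOf (ENNReal.ofReal m • μ) = μ := by
  unfold nrmOf
  rw [Measure.smul_apply, hμ.2, smul_smul, smul_eq_mul, mul_one,
    ENNReal.inv_mul_cancel (by simpa using hm) ENNReal.ofReal_ne_top, one_smul]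

lemma mass_smul {m : ℝ} (hm : 0 < m) {μ : Measure (EuclideanSpace ℝ (Fin n))} (hμ : IsPc μ) :
    massOf (ENNReal.ofReal m • μ) = m := by
  unfold massOf
  rw [Measure.smul_apply, hμ.2, smul_eq_mul, mul_one, ENNReal.toReal_ofReal hm.le]

lemma minkowski_two {q a b c d : ℝ} (hq : 1 ≤ q) (ha : 0 ≤ a) (hb : 0 ≤ b) (hc : 0 ≤ c)
    (hd : 0 ≤ d) : ((a + b) ^ q + (c + d) ^ q) ^ (1 / q) ≤
      (a ^ q + c ^ q) ^ (1 / q) + (b ^ q + d ^ q) ^ (1 / q) := by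
  have h := Real.Lp_add_le_of_nonneg (s := (Finset.univ : Finset (Fin 2))) (f := ![a, c])
    (g := ![b, d]) hq (by intro i _; fin_cases i <;> simpa) (by intro i _; fin_cases i <;> simpa)
  simpa [Fin.sum_univ_two] using h

lemma dMq_eq {p q l : ℝ} (hl : 0 < l) (μ ν : Measure (EuclideanSpace ℝ (Fin n))) :
    dMq n p q l μ ν =
      (|massOf μ - massOf ν| ^ q + (l * Wp n p (nrmOf μ) (nrmOf ν)) ^ q) ^ (1 / q) := by
  unfold dMq
  rw [Real.mul_rpow hl.le (Wp_nonneg _ _ _)]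

lemma pow_root {q a : ℝ} (hq : 1 ≤ q) (ha : 0 ≤ a) : (a ^ q) ^ (1 / q) = a := by
  rw [one_div, Real.rpow_rpow_inv ha (by linarith)]

lemma dirac_pc : IsPc (Measure.dirac (0 : EuclideanSpace ℝ (Fin n))) :=
  ⟨⟨{0}, isCompact_singleton, by simp⟩, by simp⟩

end Helpers

theorem statement14 (n : ℕ) (p q l : ℝ) (hp : 1 ≤ p) (hq : 1 ≤ q) (hl : 0 < l) :
    -- `d_{M,q}` is a distance function on `M*_c(ℝⁿ)`
    (∀ μ ν, IsMcStar μ → IsMcStar ν → 0 ≤ dMq n p q l μ ν) ∧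
    (∀ μ ν, IsMcStar μ → IsMcStar ν → (dMq n p q l μ ν = 0 ↔ μ = ν)) ∧
    (∀ μ ν, IsMcStar μ → IsMcStar ν → dMq n p q l μ ν = dMq n p q l ν μ) ∧
    (∀ μ ν ρ, IsMcStar μ → IsMcStar ν → IsMcStar ρ →
      dMq n p q l μ ρ ≤ dMq n p q l μ ν + dMq n p q l ν ρ) ∧
    -- `d_{M,∞}` is a distance function on `M*_c(ℝⁿ)`
    (∀ μ ν, IsMcStar μ → IsMcStar ν → 0 ≤ dMinfty n p l μ ν) ∧
    (∀ μ ν, IsMcStar μ → IsMcStar ν → (dMinfty n p l μ ν = 0 ↔ μ = ν)) ∧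
    (∀ μ ν, IsMcStar μ → IsMcStar ν → dMinfty n p l μ ν = dMinfty n p l ν μ) ∧
    (∀ μ ν ρ, IsMcStar μ → IsMcStar ν → IsMcStar ρ →
      dMinfty n p l μ ρ ≤ dMinfty n p l μ ν + dMinfty n p l ν ρ) ∧
    -- fiber condition: `d_{M,q}(m μ₁, m μ₂) = λ W_p(μ₁, μ₂)`
    (∀ m : ℝ, 0 < m → ∀ μ₁ μ₂, IsPc μ₁ → IsPc μ₂ →
      dMq n p q l (ENNReal.ofReal m • μ₁) (ENNReal.ofReal m • μ₂) = l * Wp n p μ₁ μ₂) ∧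
    (∀ m : ℝ, 0 < m → ∀ μ₁ μ₂, IsPc μ₁ → IsPc μ₂ →
      dMinfty n p l (ENNReal.ofReal m • μ₁) (ENNReal.ofReal m • μ₂) = l * Wp n p μ₁ μ₂) ∧
    -- `sup_{μ ∈ P_c(ℝⁿ)} d_{M,q}(m₀ μ, m μ) = |m₀ - m|`
    (∀ m₀ m : ℝ, 0 < m₀ → 0 < m →
      sSup {c : ℝ | ∃ μ, IsPc μ ∧
        c = dMq n p q l (ENNReal.ofReal m₀ • μ) (ENNReal.ofReal m • μ)} = |m₀ - m|) ∧
    (∀ m₀ m : ℝ, 0 < m₀ → 0 < m →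
      sSup {c : ℝ | ∃ μ, IsPc μ ∧
        c = dMinfty n p l (ENNReal.ofReal m₀ • μ) (ENNReal.ofReal m • μ)} = |m₀ - m|) := by
  have hq0 : 0 < q := by linarith
  have hq1 : q ≠ 0 := hq0.ne'
  have hW : ∀ μ ν : Measure (EuclideanSpace ℝ (Fin n)), 0 ≤ l * Wp n p μ ν :=
    fun μ ν => mul_nonneg hl.le (Wp_nonneg _ _ _)
  have htri : ∀ μ ν ρ : Measure (EuclideanSpace ℝ (Fin n)), IsMcStar μ → IsMcStar ν →
      IsMcStar ρ → l * Wp n p (nrmOf μ) (nrmOf ρ) ≤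
        l * Wp n p (nrmOf μ) (nrmOf ν) + l * Wp n p (nrmOf ν) (nrmOf ρ) := by
    intro μ ν ρ hμ hν hρ
    rw [← mul_add]
    exact mul_le_mul_of_nonneg_left (Wp_triangle p hp (nrm_pc hμ) (nrm_pc hν) (nrm_pc hρ)) hl.le
  have heq : ∀ μ ν : Measure (EuclideanSpace ℝ (Fin n)), IsMcStar μ → IsMcStar ν →
      |massOf μ - massOf ν| = 0 → l * Wp n p (nrmOf μ) (nrmOf ν) = 0 → μ = ν := by
    intro μ ν hμ hν h1 h2
    refine eq_of_mass_nrm hμ hν (sub_eq_zero.1 (abs_eq_zero.1 h1)) ?_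
    exact eq_of_Wp p hp (nrm_pc hμ) (nrm_pc hν) ((mul_eq_zero.1 h2).resolve_left hl.ne')
  have hqm : ∀ m₀ m : ℝ, 0 < m₀ → 0 < m → ∀ μ : Measure (EuclideanSpace ℝ (Fin n)), IsPc μ →
      dMq n p q l (ENNReal.ofReal m₀ • μ) (ENNReal.ofReal m • μ) = |m₀ - m| := by
    intro m₀ m h0 h1 μ hμ
    rw [dMq_eq hl, mass_smul h0 hμ, mass_smul h1 hμ, nrm_smul h0 hμ, nrm_smul h1 hμ,
      Wp_self p hp, mul_zero, Real.zero_rpow hq1, add_zero, pow_root hq (abs_nonneg _)]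
  have him : ∀ m₀ m : ℝ, 0 < m₀ → 0 < m → ∀ μ : Measure (EuclideanSpace ℝ (Fin n)), IsPc μ →
      dMinfty n p l (ENNReal.ofReal m₀ • μ) (ENNReal.ofReal m • μ) = |m₀ - m| := by
    intro m₀ m h0 h1 μ hμ
    rw [dMinfty, mass_smul h0 hμ, mass_smul h1 hμ, nrm_smul h0 hμ, nrm_smul h1 hμ,
      Wp_self p hp, mul_zero, max_eq_left (abs_nonneg _)]
  refine ⟨?_, ?_, ?_, ?_, ?_, ?_, ?_, ?_, ?_, ?_, ?_, ?_⟩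
  · intro μ ν _ _
    rw [dMq_eq hl]
    have := hW (nrmOf μ) (nrmOf ν)
    positivity
  · intro μ ν hμ hν
    have h1 := Real.rpow_nonneg (abs_nonneg (massOf μ - massOf ν)) q
    have h2 := Real.rpow_nonneg (hW (nrmOf μ) (nrmOf ν)) q
    constructor
    · intro h
      rw [dMq_eq hl, Real.rpow_eq_zero (add_nonneg h1 h2) (by positivity),
        add_eq_zero_iff_of_nonneg h1 h2, Real.rpow_eq_zero (abs_nonneg _) hq1,
        Real.rpow_eq_zero (hW _ _) hq1] at h
      exact heq μ ν hμ hν h.1 h.2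
    · rintro rfl
      rw [dMq_eq hl, Wp_self p hp, sub_self, abs_zero, mul_zero, Real.zero_rpow hq1, add_zero,
        Real.zero_rpow (by positivity)]
  · intro μ ν _ _
    rw [dMq_eq hl, dMq_eq hl, Wp_symm p hp, abs_sub_comm]
  · intro μ ν ρ hμ hν hρ
    rw [dMq_eq hl, dMq_eq hl, dMq_eq hl]
    refine le_trans ?_ (minkowski_two hq (abs_nonneg _) (abs_nonneg _) (hW _ _) (hW _ _))
    have h1 := Real.rpow_nonneg (abs_nonneg (massOf μ - massOf ρ)) q
    have h2 := Real.rpow_nonneg (hW (nrmOf μ) (nrmOf ρ)) q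
    refine Real.rpow_le_rpow (add_nonneg h1 h2) (add_le_add ?_ ?_) (by positivity)
    · exact Real.rpow_le_rpow (abs_nonneg _) (abs_sub_le _ _ _) hq0.le
    · exact Real.rpow_le_rpow (hW _ _) (htri μ ν ρ hμ hν hρ) hq0.le
  · intro μ ν _ _
    exact le_max_of_le_left (abs_nonneg _)
  · intro μ ν hμ hν
    constructor
    · intro h
      unfold dMinfty at h
      exact heq μ ν hμ hν (le_antisymm ((le_max_left _ _).trans h.le) (abs_nonneg _))
        (le_antisymm ((le_max_right _ _).trans h.le) (hW _ _))
    · rintro rfl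
      simp [dMinfty, Wp_self p hp]
  · intro μ ν _ _
    rw [dMinfty, dMinfty, Wp_symm p hp, abs_sub_comm]
  · intro μ ν ρ hμ hν hρ
    unfold dMinfty
    refine max_le ?_ ?_
    · exact (abs_sub_le _ (massOf ν) _).trans (add_le_add (le_max_left _ _) (le_max_left _ _))
    · exact (htri μ ν ρ hμ hν hρ).trans (add_le_add (le_max_right _ _) (le_max_right _ _))
  · intro m hm μ₁ μ₂ h1 h2
    rw [dMq_eq hl, mass_smul hm h1, mass_smul hm h2, nrm_smul hm h1, nrm_smul hm h2, sub_self,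
      abs_zero, Real.zero_rpow hq1, zero_add, pow_root hq (hW _ _)]
  · intro m hm μ₁ μ₂ h1 h2
    rw [dMinfty, mass_smul hm h1, mass_smul hm h2, nrm_smul hm h1, nrm_smul hm h2, sub_self,
      abs_zero, max_eq_right (hW _ _)]
  · intro m₀ m h0 h1
    refine Eq.trans (congrArg sSup ?_) (csSup_singleton |m₀ - m|)
    ext c
    constructor
    · rintro ⟨μ, hμ, rfl⟩
      exact hqm m₀ m h0 h1 μ hμ
    · rintro rfl
      exact ⟨_, dirac_pc, (hqm m₀ m h0 h1 _ dirac_pc).symm⟩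
  · intro m₀ m h0 h1
    refine Eq.trans (congrArg sSup ?_) (csSup_singleton |m₀ - m|)
    ext c
    constructor
    · rintro ⟨μ, hμ, rfl⟩
      exact him m₀ m h0 h1 μ hμ
    · rintro rfl
      exact ⟨_, dirac_pc, (him m₀ m h0 h1 _ dirac_pc).symm⟩
end
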